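/- arXiv:2505.12922 — 2 statements merged into one kernel-verified Lean document; each statement's English description precedes it below -/
import Mathlib

section
/- Let K ⊆ Out(F) be a conjugacy class of soft involutions such that the product set K·K contains exactly one conjugacy class of involutions of Out(F) and no element of K is a square in Out(F). Then K is the conjugacy class of an involution ψ̂ where ψ ∈ Aut(F) is a 1-involution having a canonical basis U ⊔ {x} ⊔ Y with ψu = u (u ∈ U), ψx = x⁻¹, and ψy = x y x⁻¹ (y ∈ Y), in which the set Y is finite. -/
open Pointwise

/-- A subset `S` of a free group is a basis if the canonical homomorphism
`FreeGroup S →* FreeGroup X` extending the inclusion is bijective. -/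
def FreeGroup.IsBasis {X : Type*} (S : Set (FreeGroup X)) : Prop :=
  Function.Bijective (FreeGroup.lift (fun s : S => (s : FreeGroup X)))

/-- The subgroup of inner automorphisms of a group `G`, as a subgroup of `MulAut G`. -/
def Inn (G : Type*) [Group G] : Subgroup (MulAut G) :=
  (MulAut.conj : G →* MulAut G).range

instance Inn.normal (G : Type*) [Group G] : (Inn G).Normal := by
  constructor
  rintro - ⟨g, rfl⟩ σ
  refine ⟨σ g, ?_⟩
  ext x
  simp [MulAut.conj, MulAut.mul_apply, mul_assoc]

/-- The outer automorphism group `Out G = Aut G / Inn G`. -/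
abbrev OutAut (G : Type*) [Group G] := MulAut G ⧸ Inn G

/-- The natural homomorphism `Aut G → Out G`. -/
def toOut {G : Type*} [Group G] : MulAut G →* OutAut G :=
  QuotientGroup.mk' (Inn G)

/-- `g` is an involution of the group `G`. -/
def IsInvolution {G : Type*} [Group G] (g : G) : Prop :=
  g ≠ 1 ∧ g ^ 2 = 1

/-- A subset of a group is anti-commutative if its elements pairwise do not commute. -/
def AntiCommSet {G : Type*} [Group G] (s : Set G) : Prop :=
  ∀ a ∈ s, ∀ b ∈ s, a ≠ b → a * b ≠ b * a

/-- A decomposition `U ⊔ S ⊔ ⊔_{x ∈ S} Y x` of a basis of a free group. -/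
structure IsBasisDecomposition {X : Type*} (U S : Set (FreeGroup X))
    (Y : FreeGroup X → Set (FreeGroup X)) : Prop where
  isBasis : FreeGroup.IsBasis (U ∪ S ∪ ⋃ x ∈ S, Y x)
  disjUS : Disjoint U S
  disjUY : ∀ x ∈ S, Disjoint U (Y x)
  disjSY : ∀ x ∈ S, Disjoint S (Y x)
  disjYY : ∀ x ∈ S, ∀ x' ∈ S, x ≠ x' → Disjoint (Y x) (Y x')

/-- `U ⊔ S ⊔ ⊔_{x ∈ S} Y x` is a canonical basis for the (soft) involution `φ`:
`φ` fixes `U` pointwise, inverts the elements of `S` and conjugates the elements of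
`Y x` by `x`. -/
def IsCanonicalBasis {X : Type*} (φ : MulAut (FreeGroup X)) (U S : Set (FreeGroup X))
    (Y : FreeGroup X → Set (FreeGroup X)) : Prop :=
  IsBasisDecomposition U S Y ∧
    (∀ u ∈ U, φ u = u) ∧ (∀ x ∈ S, φ x = x⁻¹) ∧
    (∀ x ∈ S, ∀ y ∈ Y x, φ y = x * y * x⁻¹)

/-- A soft involution of `Aut F`: an involution admitting a canonical basis. -/
def IsSoftInvolution {X : Type*} (φ : MulAut (FreeGroup X)) : Prop :=
  IsInvolution φ ∧ ∃ U S Y, IsCanonicalBasis φ U S Y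

/-- A soft involution of `Out F`: an involution induced by a soft involution of `Aut F`. -/
def IsSoftOutInvolution {X : Type*} (f : OutAut (FreeGroup X)) : Prop :=
  IsInvolution f ∧ ∃ φ, IsSoftInvolution φ ∧ toOut φ = f

/-- A `1`-involution of `Aut F`: a soft involution whose canonical bases have exactly
one block. -/
def IsOneInvolution {X : Type*} (ψ : MulAut (FreeGroup X)) : Prop :=
  IsInvolution ψ ∧ ∃ (U Y : Set (FreeGroup X)) (x : FreeGroup X),
    IsCanonicalBasis ψ U {x} (fun _ => Y)

/-- A `1`-involution of `Out F`: an involution induced by a `1`-involution of `Aut F`. -/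
def IsOneOutInvolution {X : Type*} (f : OutAut (FreeGroup X)) : Prop :=
  IsInvolution f ∧ ∃ ψ, IsOneInvolution ψ ∧ toOut ψ = f

/-- An extremal involution of `Aut F`: an involution inverting one element of a suitable
basis and fixing all other elements of that basis. -/
def IsExtremalInvolution {X : Type*} (φ : MulAut (FreeGroup X)) : Prop :=
  IsInvolution φ ∧ ∃ (B : Set (FreeGroup X)) (x : FreeGroup X),
    FreeGroup.IsBasis B ∧ x ∈ B ∧ φ x = x⁻¹ ∧ ∀ b ∈ B, b ≠ x → φ b = b

/-- An extremal involution of `Out F`: an involution induced by an extremal involution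
of `Aut F`. -/
def IsExtremalOutInvolution {X : Type*} (f : OutAut (FreeGroup X)) : Prop :=
  IsInvolution f ∧ ∃ φ, IsExtremalInvolution φ ∧ toOut φ = f

/-- A symmetry of `Aut F`: an involution inverting all elements of some basis. -/
def IsSymmetryAut {X : Type*} (θ : MulAut (FreeGroup X)) : Prop :=
  IsInvolution θ ∧ ∃ B : Set (FreeGroup X), FreeGroup.IsBasis B ∧ ∀ b ∈ B, θ b = b⁻¹

/-- A symmetry of `Out F`: an involution whose full preimage in `Aut F` contains a
symmetry. -/
def IsSymmetryOut {X : Type*} (f : OutAut (FreeGroup X)) : Prop :=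
  IsInvolution f ∧ ∃ θ, IsSymmetryAut θ ∧ toOut θ = f

/-- Condition (★): the product set `K·K` contains exactly one conjugacy class of
involutions, and no element of `K` is a square. -/
def StarCondition {G : Type*} [Group G] (K : Set G) : Prop :=
  (∃ c ∈ K * K, IsInvolution c ∧ ∀ d ∈ K * K, IsInvolution d → IsConj c d) ∧
    ∀ k ∈ K, ¬ ∃ g : G, g ^ 2 = k

section Basis

variable {ι ι' F H : Type*} [Group F] [Group H]

@[simp]
lemma FreeGroupBasis.lift_coe (b : FreeGroupBasis ι F) (f : ι → H) (i : ι) :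
    b.lift f (b i) = f i := by
  simp [FreeGroupBasis.lift]

/-- A family `v` is a basis as soon as a given basis can be rewritten in terms of `v` by words
`w` that are inverse to `v`. -/
lemma FreeGroupBasis.exists_of_inverse_words (b : FreeGroupBasis ι F) (v : ι' → F)
    (w : ι → FreeGroup ι') (hw : ∀ i, FreeGroup.lift v (w i) = b i)
    (hv : ∀ j, b.lift w (v j) = FreeGroup.of j) :
    ∃ b' : FreeGroupBasis ι' F, ∀ j, b' j = v j := by
  refine ⟨⟨MonoidHom.toMulEquiv (b.lift w) (FreeGroup.lift v) ?_ ?_⟩, fun j => ?_⟩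
  · exact b.ext_hom _ _ fun i => by simp [hw]
  · exact FreeGroup.ext_hom _ _ fun j => by simp [hv]
  · change FreeGroup.lift v (FreeGroup.of j) = v j
    simp

lemma FreeGroupBasis.mulAut_ext (b : FreeGroupBasis ι F) {φ ψ : MulAut F}
    (h : ∀ i, φ (b i) = ψ (b i)) : φ = ψ := by
  have := b.ext_hom φ.toMonoidHom ψ.toMonoidHom h
  ext a
  exact DFunLike.congr_fun this a

/-- The automorphism permuting a basis. -/
def FreeGroupBasis.permAut (b : FreeGroupBasis ι F) (σ : Equiv.Perm ι) : MulAut F :=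
  (b.repr.trans (FreeGroup.freeGroupCongr σ)).trans b.repr.symm

@[simp]
lemma FreeGroupBasis.permAut_apply (b : FreeGroupBasis ι F) (σ : Equiv.Perm ι) (i : ι) :
    b.permAut σ (b i) = b (σ i) := by
  simp [FreeGroupBasis.permAut]
  rfl

lemma FreeGroupBasis.permAut_inv_apply (b : FreeGroupBasis ι F) (σ : Equiv.Perm ι) (i : ι) :
    (b.permAut σ)⁻¹ (b i) = b (σ⁻¹ i) := by
  rw [MulAut.inv_apply, MulEquiv.symm_apply_eq]
  simp

lemma FreeGroupBasis.isBasis_range {X : Type*} (b : FreeGroupBasis ι (FreeGroup X)) :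
    FreeGroup.IsBasis (Set.range b) := by
  have key : FreeGroup.lift (fun s : Set.range b => (s : FreeGroup X)) =
      ((FreeGroup.freeGroupCongr (Equiv.ofInjective b b.injective).symm).trans
        b.repr.symm).toMonoidHom := by
    refine FreeGroup.ext_hom _ _ ?_
    rintro ⟨_, i, rfl⟩
    have : (Equiv.ofInjective b b.injective).symm ⟨b i, i, rfl⟩ = i := by
      rw [Equiv.symm_apply_eq]; rfl
    simp [this]
    rfl
  unfold FreeGroup.IsBasis
  rw [key]
  exact MulEquiv.bijective _

/-- The basis indexed by a subset satisfying `FreeGroup.IsBasis`. -/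
noncomputable def FreeGroup.IsBasis.basis {X : Type*} {S : Set (FreeGroup X)}
    (h : FreeGroup.IsBasis S) : FreeGroupBasis S (FreeGroup X) :=
  ⟨(MulEquiv.ofBijective _ h).symm⟩

@[simp]
lemma FreeGroup.IsBasis.basis_apply {X : Type*} {S : Set (FreeGroup X)}
    (h : FreeGroup.IsBasis S) (s : S) : h.basis s = s := by
  change FreeGroup.lift (fun s : S => (s : FreeGroup X)) (FreeGroup.of s) = s
  simp

lemma FreeGroupBasis.infinite_index {X : Type*} [Infinite X]
    (b : FreeGroupBasis ι (FreeGroup X)) : Infinite ι := by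
  by_contra h
  rw [not_infinite_iff_finite] at h
  let M := Multiplicative (ZMod 2)
  have e : (ι → M) ≃ (X → M) := b.lift.trans FreeGroup.lift.symm
  have : Finite (X → M) := Finite.of_equiv _ e
  obtain ⟨a, a', h⟩ := exists_pair_ne M
  classical
  have hinj : Function.Injective (fun x : X => Function.update (fun _ : X => a) x a') := by
    intro x y hxy
    by_contra hne
    have := congrFun hxy x
    simp [Function.update_of_ne hne] at this
    exact h this.symm
  exact not_finite_iff_infinite.2 ‹Infinite X› (Finite.of_injective _ hinj)

/-- The permutation exchanging two disjoint injective families. -/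
lemma exists_perm_swap {P : Type*} (a a' : P → ι)
    (hinj : Function.Injective (Sum.elim a a')) :
    ∃ σ : Equiv.Perm ι, (∀ p, σ (a p) = a' p) ∧ (∀ p, σ (a' p) = a p) ∧
      (∀ i, (∀ p, i ≠ a p) → (∀ p, i ≠ a' p) → σ i = i) ∧ σ⁻¹ = σ := by
  classical
  let e := Equiv.ofInjective _ hinj
  let σ := Equiv.Perm.extendDomain (Equiv.sumComm P P) e
  have h1 : ∀ p, σ (a p) = a' p := fun p =>
    Equiv.Perm.extendDomain_apply_image (Equiv.sumComm P P) e (Sum.inl p)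
  have h2 : ∀ p, σ (a' p) = a p := fun p =>
    Equiv.Perm.extendDomain_apply_image (Equiv.sumComm P P) e (Sum.inr p)
  have h3 : ∀ i, (∀ p, i ≠ a p) → (∀ p, i ≠ a' p) → σ i = i := by
    intro i hi hi'
    refine Equiv.Perm.extendDomain_apply_not_subtype _ _ ?_
    rintro ⟨p | p, rfl⟩
    · exact hi p rfl
    · exact hi' p rfl
  refine ⟨σ, h1, h2, h3, ?_⟩
  rw [inv_eq_iff_mul_eq_one]
  ext i
  by_cases ha : ∃ p, i = a p
  · obtain ⟨p, rfl⟩ := ha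
    simp [h1, h2]
  by_cases ha' : ∃ p, i = a' p
  · obtain ⟨p, rfl⟩ := ha'
    simp [h1, h2]
  push Not at ha ha'
  simp [h3 i ha ha']

end Basis

section Outer

variable {F : Type*} [Group F]

@[simp]
lemma toOut_conj_mul (g : F) (φ : MulAut F) : toOut (MulAut.conj g * φ) = toOut φ := by
  have : toOut (MulAut.conj g) = 1 := (QuotientGroup.eq_one_iff _).2 ⟨g, rfl⟩
  rw [map_mul, this, one_mul]

lemma exists_conj_mul_of_toOut_eq {φ ψ : MulAut F} (h : toOut φ = toOut ψ) :
    ∃ g, ψ = MulAut.conj g * φ := by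
  have h' : toOut (ψ * φ⁻¹) = 1 := by rw [map_mul, map_inv, h, mul_inv_cancel]
  obtain ⟨g, hg⟩ := (QuotientGroup.eq_one_iff _).1 h'
  exact ⟨g, by rw [hg, inv_mul_cancel_right]⟩

lemma exists_conj_of_isConj_toOut {φ ψ : MulAut F} (h : IsConj (toOut φ) (toOut ψ)) :
    ∃ (χ : MulAut F) (g : F), ψ = MulAut.conj g * (χ * φ * χ⁻¹) := by
  obtain ⟨c, hc⟩ := isConj_iff.1 h
  obtain ⟨χ, rfl⟩ := QuotientGroup.mk'_surjective (Inn F) c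
  obtain ⟨g, hg⟩ := exists_conj_mul_of_toOut_eq (φ := χ * φ * χ⁻¹) (ψ := ψ)
    (by rw [map_mul, map_mul, map_inv]; exact hc)
  exact ⟨χ, g, hg⟩

/-- The homomorphisms to the group of order three that are inverted by `θ`. -/
def InvertedHom (θ : MulAut F) : Set (F →* Multiplicative (ZMod 3)) :=
  {h | ∀ a, h (θ a) = (h a)⁻¹}

lemma card_invertedHom_eq_of_isConj {φ ψ : MulAut F} (h : IsConj (toOut φ) (toOut ψ)) :
    Nat.card (InvertedHom φ) = Nat.card (InvertedHom ψ) := by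
  obtain ⟨χ, g, rfl⟩ := exists_conj_of_isConj_toOut h
  refine Nat.card_congr ⟨fun f => ⟨f.1.comp (χ⁻¹).toMonoidHom, fun a => ?_⟩,
    fun f => ⟨f.1.comp χ.toMonoidHom, fun a => ?_⟩, fun f => ?_, fun f => ?_⟩
  · have := f.2 (χ⁻¹ a)
    simpa [mul_comm] using this
  · have := f.2 (χ a)
    simpa [mul_comm] using this
  · ext a; simp
  · ext a; simp

lemma card_invertedHom {ι T : Type*} [Finite T] (b : FreeGroupBasis ι F) (θ : MulAut F)
    (m : T → ι) (hm : Function.Injective m)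
    (hinv : ∀ t, ∃ g, θ (b (m t)) = g * (b (m t))⁻¹ * g⁻¹)
    (hfix : ∀ i, (∀ t, i ≠ m t) → ∃ g, θ (b i) = g * b i * g⁻¹) :
    Nat.card (InvertedHom θ) = 3 ^ Nat.card T := by
  classical
  have hinv' : ∀ (h : F →* Multiplicative (ZMod 3)) t, h (θ (b (m t))) = (h (b (m t)))⁻¹ := by
    intro h t
    obtain ⟨g, hg⟩ := hinv t
    rw [hg]; simp [mul_comm]
  have hfix' : ∀ (h : F →* Multiplicative (ZMod 3)) i, (∀ t, i ≠ m t) →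
      h (θ (b i)) = h (b i) := by
    intro h i hi
    obtain ⟨g, hg⟩ := hfix i hi
    rw [hg]; simp [mul_comm]
  have htor : ∀ z : Multiplicative (ZMod 3), z = z⁻¹ → z = 1 := by decide
  let ext (c : T → Multiplicative (ZMod 3)) : F →* Multiplicative (ZMod 3) :=
    b.lift (Function.extend m c 1)
  have hext (c) (t) : ext c (b (m t)) = c t := by simp [ext, hm.extend_apply]
  have hext' (c) (i) (hi : ∀ t, i ≠ m t) : ext c (b i) = 1 := by
    simp only [ext, FreeGroupBasis.lift_coe]
    exact Function.extend_apply' _ _ _ fun ⟨t, ht⟩ => hi t ht.symm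
  have e : InvertedHom θ ≃ (T → Multiplicative (ZMod 3)) := by
    refine ⟨fun h t => h.1 (b (m t)), fun c => ⟨ext c, ?_⟩, ?_, ?_⟩
    · have : (ext c).comp θ.toMonoidHom = (ext c)⁻¹ := by
        refine b.ext_hom _ _ fun i => ?_
        by_cases hi : ∃ t, i = m t
        · obtain ⟨t, rfl⟩ := hi
          simpa using hinv' _ t
        · push Not at hi
          have := hfix' (ext c) i hi
          simp only [hext' c i hi] at this
          simp [hext' c i hi, this]
      exact fun a => DFunLike.congr_fun this a
    · rintro ⟨h, hh⟩
      refine Subtype.ext (b.ext_hom _ _ fun i => ?_)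
      by_cases hi : ∃ t, i = m t
      · obtain ⟨t, rfl⟩ := hi
        simp [hext]
      · push Not at hi
        have h1 := hh (b i)
        rw [hfix' h i hi] at h1
        simp [hext' _ i hi, htor _ h1]
    · intro c
      ext1 t
      exact hext c t
  rw [Nat.card_congr e, Nat.card_fun]
  congr 1
  simp

lemma toOut_ne_one_of_inverts {ι : Type*} (b : FreeGroupBasis ι F) {θ : MulAut F} (i : ι)
    (h : ∃ g, θ (b i) = g * (b i)⁻¹ * g⁻¹) : toOut θ ≠ 1 := by
  intro h1
  obtain ⟨g, hg⟩ := exists_conj_mul_of_toOut_eq (φ := 1) (ψ := θ) (by rw [h1, map_one])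
  obtain ⟨g', hg'⟩ := h
  let f : F →* Multiplicative (ZMod 3) := b.lift fun _ => Multiplicative.ofAdd 1
  have h2 : f (b i) = (f (b i))⁻¹ := by
    have := congrArg f hg'
    rw [hg] at this
    simpa [mul_comm] using this
  rw [show f (b i) = Multiplicative.ofAdd 1 by simp [f]] at h2
  revert h2
  decide

/-- If `φ` acts on blocks `a ⟨t, -⟩` as a soft involution conjugated by `c t`, and as conjugation
by `c t` on copies `a' ⟨t, -⟩` of these blocks, then the product of `φ` with its conjugate by the
permutation exchanging the blocks with their copies is a soft involution with blocks `a ⟨t, -⟩`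
and `a' ⟨t, -⟩`. -/
lemma exists_product_of_block_copies {ι T : Type*} {Z : T → Type*} (b : FreeGroupBasis ι F)
    {φ : MulAut F} (hφ : ∀ i, φ (φ (b i)) = b i) (a a' : (Σ t, Option (Z t)) → ι)
    (hinj : Function.Injective (Sum.elim a a')) (c : T → F)
    (hc : ∀ t, φ (c t) = (c t)⁻¹)
    (hcb : ∀ t, c t = 1 ∨ ∃ i, c t = b i ∧ (∀ p, i ≠ a p) ∧ ∀ p, i ≠ a' p)
    (hcopy : ∀ p, φ (b (a' p)) = c p.1 * b (a' p) * (c p.1)⁻¹)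
    (htop : ∀ t, φ (b (a ⟨t, none⟩)) = c t * (b (a ⟨t, none⟩))⁻¹ * (c t)⁻¹)
    (hblock : ∀ t z, φ (b (a ⟨t, some z⟩)) =
      c t * (b (a ⟨t, none⟩) * b (a ⟨t, some z⟩) * (b (a ⟨t, none⟩))⁻¹) * (c t)⁻¹)
    (hrest : ∀ i, (∀ p, i ≠ a p) → (∀ p, i ≠ a' p) →
      ∀ α : MulAut F, (∀ j, (∀ p, j ≠ a p) → (∀ p, j ≠ a' p) → α (b j) = b j) →
        α (φ (b i)) = φ (b i)) :
    ∃ α : MulAut F, ∃ θ : MulAut F, θ = φ * (α * φ * α⁻¹) ∧ θ ^ 2 = 1 ∧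
      (∀ t, θ (b (a ⟨t, none⟩)) = (b (a ⟨t, none⟩))⁻¹) ∧
      (∀ t z, θ (b (a ⟨t, some z⟩)) =
        b (a ⟨t, none⟩) * b (a ⟨t, some z⟩) * (b (a ⟨t, none⟩))⁻¹) ∧
      (∀ t, θ (b (a' ⟨t, none⟩)) = (b (a' ⟨t, none⟩))⁻¹) ∧
      (∀ t z, θ (b (a' ⟨t, some z⟩)) =
        b (a' ⟨t, none⟩) * b (a' ⟨t, some z⟩) * (b (a' ⟨t, none⟩))⁻¹) ∧
      (∀ i, (∀ p, i ≠ a p) → (∀ p, i ≠ a' p) → θ (b i) = b i) := by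
  obtain ⟨σ, hσ, hσ', hσr, hσi⟩ := exists_perm_swap a a' hinj
  set α := b.permAut σ with hα
  have αa : ∀ p, α (b (a p)) = b (a' p) := fun p => by simp [hα, hσ]
  have αa' : ∀ p, α (b (a' p)) = b (a p) := fun p => by simp [hα, hσ']
  have αr : ∀ i, (∀ p, i ≠ a p) → (∀ p, i ≠ a' p) → α (b i) = b i := fun i h h' => by
    simp [hα, hσr i h h']
  have αi : α⁻¹ = α := by
    refine b.mulAut_ext fun i => ?_
    rw [hα, b.permAut_inv_apply, hσi, b.permAut_apply]
  have αc : ∀ t, α (c t) = c t := by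
    intro t
    rcases hcb t with h | ⟨i, h, h1, h2⟩
    · simp [h]
    · rw [h, αr i h1 h2]
  have θ1 : ∀ t, (φ * (α * φ * α⁻¹)) (b (a ⟨t, none⟩)) = (b (a ⟨t, none⟩))⁻¹ := by
    intro t
    rw [αi]
    simp only [MulAut.mul_apply, αa, hcopy, map_mul, map_inv, αc, αa', hc, htop]
    group
  have θ2 : ∀ t z, (φ * (α * φ * α⁻¹)) (b (a ⟨t, some z⟩)) =
      b (a ⟨t, none⟩) * b (a ⟨t, some z⟩) * (b (a ⟨t, none⟩))⁻¹ := by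
    intro t z
    rw [αi]
    simp only [MulAut.mul_apply, αa, hcopy, map_mul, map_inv, αc, αa', hc, hblock]
    group
  have θ3 : ∀ t, (φ * (α * φ * α⁻¹)) (b (a' ⟨t, none⟩)) = (b (a' ⟨t, none⟩))⁻¹ := by
    intro t
    rw [αi]
    simp only [MulAut.mul_apply, αa', htop, map_mul, map_inv, αc, αa, hc, hcopy]
    group
  have θ4 : ∀ t z, (φ * (α * φ * α⁻¹)) (b (a' ⟨t, some z⟩)) =
      b (a' ⟨t, none⟩) * b (a' ⟨t, some z⟩) * (b (a' ⟨t, none⟩))⁻¹ := by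
    intro t z
    rw [αi]
    simp only [MulAut.mul_apply, αa', hblock, map_mul, map_inv, αc, αa, hc, hcopy]
    group
  have θ5 : ∀ i, (∀ p, i ≠ a p) → (∀ p, i ≠ a' p) →
      (φ * (α * φ * α⁻¹)) (b i) = b i := by
    intro i h h'
    rw [αi]
    simp only [MulAut.mul_apply, αr i h h', hrest i h h' α αr, hφ]
  obtain ⟨θ, hθ⟩ : ∃ θ, θ = φ * (α * φ * α⁻¹) := ⟨_, rfl⟩
  rw [← hθ] at θ1 θ2 θ3 θ4 θ5
  refine ⟨α, θ, hθ, b.mulAut_ext fun i => ?_, θ1, θ2, θ3, θ4, θ5⟩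
  rw [pow_two, MulAut.mul_apply, MulAut.one_apply]
  by_cases h : ∃ p, i = a p
  · obtain ⟨⟨t, _ | z⟩, rfl⟩ := h
    · rw [θ1, map_inv, θ1, inv_inv]
    · rw [θ2]
      simp only [map_mul, map_inv, θ1, θ2]
      group
  by_cases h' : ∃ p, i = a' p
  · obtain ⟨⟨t, _ | z⟩, rfl⟩ := h'
    · rw [θ3, map_inv, θ3, inv_inv]
    · rw [θ4]
      simp only [map_mul, map_inv, θ3, θ4]
      group
  push Not at h h'
  rw [θ5 i h h', θ5 i h h']

end Outer

section Model

variable {F : Type*} [Group F]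

/-- An indexed canonical basis of the soft involution `φ`. The parts of the basis are the `N i`,
the part `N i₀` being the fixed one; `φ` inverts `x i`, conjugates the elements of `N i` by `x i`,
and `x i₀ = 1`, so that all parts play the same role up to inner automorphisms. -/
structure SoftModel (φ : MulAut F) {I : Type*} (N : I → Type*) (i₀ : I) where
  /-- the underlying basis -/
  basis : FreeGroupBasis ({i // i ≠ i₀} ⊕ Σ i, N i) F
  /-- the inverted elements -/
  x : I → F
  x_base : x i₀ = 1
  basis_inl : ∀ i, basis (Sum.inl i) = x i
  map_x : ∀ i, φ (x i) = (x i)⁻¹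
  map_y : ∀ i y, φ (basis (Sum.inr ⟨i, y⟩)) = x i * basis (Sum.inr ⟨i, y⟩) * (x i)⁻¹

namespace SoftModel

variable {φ : MulAut F} {I : Type*} {N : I → Type*} {i₀ : I}

lemma map_map_basis (M : SoftModel φ N i₀) (i) : φ (φ (M.basis i)) = M.basis i := by
  rcases i with i | ⟨i, y⟩
  · rw [M.basis_inl, M.map_x, map_inv, M.map_x, inv_inv]
  · simp only [M.map_y, map_mul, map_inv, M.map_x]
    group

lemma sq_eq_one (M : SoftModel φ N i₀) : φ ^ 2 = 1 :=
  M.basis.mulAut_ext fun i => by rw [pow_two, MulAut.mul_apply, M.map_map_basis, MulAut.one_apply]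

lemma map_map (M : SoftModel φ N i₀) (a : F) : φ (φ a) = a := by
  rw [← MulAut.mul_apply, ← pow_two, M.sq_eq_one, MulAut.one_apply]

open Classical in
/-- The formal counterpart of the elements `x i`. -/
noncomputable def wordX (N : I → Type*) (i₀ i : I) : FreeGroup ({i // i ≠ i₀} ⊕ Σ i, N i) :=
  if h : i = i₀ then 1 else FreeGroup.of (Sum.inl ⟨i, h⟩)

@[simp]
lemma wordX_base : wordX N i₀ i₀ = 1 := by simp [wordX]

lemma wordX_of_ne (i : {i // i ≠ i₀}) : wordX N i₀ i = FreeGroup.of (Sum.inl i) := by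
  simp [wordX, i.2]

/-- Change of the fixed part. -/
lemma baseChange (M : SoftModel φ N i₀) (i₁ : I) :
    Nonempty (SoftModel (MulAut.conj (M.x i₁)⁻¹ * φ) N i₁) := by
  let v : ({i // i ≠ i₁} ⊕ Σ i, N i) → F :=
    Sum.elim (fun i => (M.x i₁)⁻¹ * M.x i) fun p => M.basis (Sum.inr p)
  let w : ({i // i ≠ i₀} ⊕ Σ i, N i) → FreeGroup ({i // i ≠ i₁} ⊕ Σ i, N i) :=
    Sum.elim (fun i => (wordX N i₁ i₀)⁻¹ * wordX N i₁ i) fun p => FreeGroup.of (Sum.inr p)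
  have hv : ∀ i, FreeGroup.lift v (wordX N i₁ i) = (M.x i₁)⁻¹ * M.x i := by
    intro i
    by_cases h : i = i₁
    · subst h; simp
    · rw [wordX_of_ne ⟨i, h⟩]; simp [v]
  have hw : ∀ i, M.basis.lift w (M.x i) = (wordX N i₁ i₀)⁻¹ * wordX N i₁ i := by
    intro i
    by_cases h : i = i₀
    · subst h; simp [M.x_base]
    · rw [← M.basis_inl ⟨i, h⟩]; simp [w]
  obtain ⟨b', hb'⟩ := M.basis.exists_of_inverse_words v w
    (by
      rintro (i | p)
      · simp [w, hv, M.basis_inl, M.x_base]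
      · simp [w, v])
    (by
      rintro (i | p)
      · simp only [v, Sum.elim_inl, map_mul, map_inv, hw, wordX_base, ← wordX_of_ne]
        group
      · simp [w, v])
  refine ⟨⟨b', fun i => (M.x i₁)⁻¹ * M.x i, by simp, fun i => by simp [hb', v], fun i => ?_,
    fun i y => ?_⟩⟩
  · simp [M.map_x]
  · simp only [hb', v, Sum.elim_inr, MulAut.mul_apply, MulAut.conj_apply, M.map_y]
    group

/-- The product of `φ` and a conjugate of `φ`, obtained by exchanging the blocks `N (j t)` with
subsets of the parts `N (k t)`. -/
lemma exists_product (M : SoftModel φ N i₀) {T : Type*} (j k : T → I)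
    (hj : Function.Injective j) (hjk : ∀ t t', k t ≠ j t') (hj₀ : ∀ t, j t ≠ i₀)
    (e : ∀ t, Option (N (j t)) → N (k t))
    (he : Function.Injective fun p : Σ t, Option (N (j t)) =>
      (⟨k p.1, e p.1 p.2⟩ : Σ i, N i)) :
    ∃ b : FreeGroupBasis ({i // i ≠ i₀} ⊕ Σ i, N i) F, ∃ α θ : MulAut F,
      θ = φ * (α * φ * α⁻¹) ∧ θ ^ 2 = 1 ∧
      (∀ t, θ (b (Sum.inl ⟨j t, hj₀ t⟩)) = (b (Sum.inl ⟨j t, hj₀ t⟩))⁻¹) ∧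
      (∀ t z, θ (b (Sum.inr ⟨j t, z⟩)) =
        b (Sum.inl ⟨j t, hj₀ t⟩) * b (Sum.inr ⟨j t, z⟩) * (b (Sum.inl ⟨j t, hj₀ t⟩))⁻¹) ∧
      (∀ t, θ (b (Sum.inr ⟨k t, e t none⟩)) = (b (Sum.inr ⟨k t, e t none⟩))⁻¹) ∧
      (∀ t z, θ (b (Sum.inr ⟨k t, e t (some z)⟩)) =
        b (Sum.inr ⟨k t, e t none⟩) * b (Sum.inr ⟨k t, e t (some z)⟩) *
          (b (Sum.inr ⟨k t, e t none⟩))⁻¹) ∧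
      (∀ i : {i // i ≠ i₀}, (∀ t, (i : I) ≠ j t) → θ (b (Sum.inl i)) = b (Sum.inl i)) ∧
      (∀ i y, (∀ t, i ≠ j t) → (∀ t z, (⟨i, y⟩ : Σ i, N i) ≠ ⟨k t, e t z⟩) →
        θ (b (Sum.inr ⟨i, y⟩)) = b (Sum.inr ⟨i, y⟩)) := by
  classical
  let κ : I → I := Function.extend j k fun _ => i₀
  have κj : ∀ t, κ (j t) = k t := fun t => hj.extend_apply _ _ t
  have κr : ∀ i, (∀ t, i ≠ j t) → κ i = i₀ := fun i hi =>
    Function.extend_apply' _ _ _ fun ⟨t, ht⟩ => hi t ht.symm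
  have κ0 : κ i₀ = i₀ := κr _ fun t => (hj₀ t).symm
  have κκ : ∀ i, κ (κ i) = i₀ := by
    intro i
    by_cases h : ∃ t, i = j t
    · obtain ⟨t, rfl⟩ := h
      rw [κj, κr _ (hjk t)]
    · push Not at h
      rw [κr i h, κ0]
  let v : ({i // i ≠ i₀} ⊕ Σ i, N i) → F :=
    Sum.elim (fun i => (M.x (κ i))⁻¹ * M.x i) fun p => M.basis (Sum.inr p)
  let w : ({i // i ≠ i₀} ⊕ Σ i, N i) → FreeGroup ({i // i ≠ i₀} ⊕ Σ i, N i) :=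
    Sum.elim (fun i => wordX N i₀ (κ i) * wordX N i₀ i) fun p => FreeGroup.of (Sum.inr p)
  have hv : ∀ i, FreeGroup.lift v (wordX N i₀ i) = (M.x (κ i))⁻¹ * M.x i := by
    intro i
    by_cases h : i = i₀
    · subst h; simp [κ0]
    · rw [wordX_of_ne ⟨i, h⟩]; simp [v]
  have hw : ∀ i, M.basis.lift w (M.x i) = wordX N i₀ (κ i) * wordX N i₀ i := by
    intro i
    by_cases h : i = i₀
    · subst h; simp [M.x_base, κ0]
    · rw [← M.basis_inl ⟨i, h⟩]; simp [w]
  obtain ⟨b, hb⟩ := M.basis.exists_of_inverse_words v w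
    (by
      rintro (i | p)
      · simp [w, hv, M.basis_inl, M.x_base, κκ]
      · simp [w, v])
    (by
      rintro (i | p)
      · simp only [v, Sum.elim_inl, map_mul, map_inv, hw, wordX_base, ← wordX_of_ne, κκ]
        group
      · simp [w, v])
  have bj : ∀ t, b (Sum.inl ⟨j t, hj₀ t⟩) = (M.x (k t))⁻¹ * M.x (j t) := by
    intro t; simp [hb, v, κj]
  have br : ∀ i : {i // i ≠ i₀}, (∀ t, (i : I) ≠ j t) → b (Sum.inl i) = M.x i := by
    intro i hi; simp [hb, v, κr _ hi, M.x_base]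
  have by' : ∀ p, b (Sum.inr p) = M.basis (Sum.inr p) := fun p => by simp [hb, v]
  let a : (Σ t, Option (N (j t))) → ({i // i ≠ i₀} ⊕ Σ i, N i) := fun p =>
    p.2.elim (Sum.inl ⟨j p.1, hj₀ p.1⟩) fun y => Sum.inr ⟨j p.1, y⟩
  let a' : (Σ t, Option (N (j t))) → ({i // i ≠ i₀} ⊕ Σ i, N i) := fun p =>
    Sum.inr ⟨k p.1, e p.1 p.2⟩
  have ha : Function.Injective a := by
    rintro ⟨t, _ | y⟩ ⟨t', _ | y'⟩ h
    · have := hj (by simpa [a] using h); subst this; rfl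
    · simp [a] at h
    · simp [a] at h
    · simp only [a, Option.elim, Sum.inr.injEq, Sigma.mk.injEq] at h
      have := hj h.1
      subst this
      simp at h
      rw [h]
  have hneI : ∀ (i : {i // i ≠ i₀}), (∀ t, (i : I) ≠ j t) →
      (∀ p, Sum.inl i ≠ a p) ∧ ∀ p, Sum.inl i ≠ a' p := by
    intro i hi
    refine ⟨?_, fun p => by simp [a']⟩
    rintro ⟨t, _ | y⟩ h
    · exact hi t (by simpa [a] using congrArg Subtype.val (Sum.inl_injective h))
    · simp [a] at h
  obtain ⟨α, θ, h1, h2, h3, h4, h5, h6, h7⟩ := exists_product_of_block_copies b (φ := φ)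
    (fun i => M.map_map _) a a'
    (by
      refine ha.sumElim (fun p p' h => he (by simpa [a'] using h)) ?_
      rintro ⟨t, _ | y⟩ p h
      · simp [a, a'] at h
      · simp only [a, a', Option.elim, Sum.inr.injEq, Sigma.mk.injEq] at h
        exact hjk _ _ h.1.symm)
    (fun t => M.x (k t)) (fun t => M.map_x _)
    (by
      intro t
      by_cases h : k t = i₀
      · left; rw [h, M.x_base]
      · right
        exact ⟨Sum.inl ⟨k t, h⟩, (br ⟨k t, h⟩ (hjk t)).symm, hneI ⟨k t, h⟩ (hjk t)⟩)
    (by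
      rintro ⟨t, z⟩
      simp only [a', by']
      exact M.map_y _ _)
    (by
      intro t
      simp only [a, Option.elim, bj, map_mul, map_inv, M.map_x]
      group)
    (by
      intro t z
      simp only [a, Option.elim, bj, by', M.map_y]
      group)
    (by
      intro i hi hi' α hα
      have αx : ∀ i, (∀ t, i ≠ j t) → α (M.x i) = M.x i := by
        intro i hi
        by_cases h : i = i₀
        · rw [h, M.x_base, map_one]
        · rw [← br ⟨i, h⟩ hi]
          exact hα _ (hneI ⟨i, h⟩ hi).1 (hneI ⟨i, h⟩ hi).2
      rcases i with i | ⟨i, y⟩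
      · have hij : ∀ t, (i : I) ≠ j t := fun t h =>
          hi ⟨t, none⟩ (by simp [a, ← h])
        rw [br i hij, M.map_x, map_inv, αx _ hij]
      · have hij : ∀ t, i ≠ j t := by
          rintro t rfl
          exact hi ⟨t, some y⟩ rfl
        have := hα _ hi hi'
        rw [by'] at this ⊢
        simp only [M.map_y, map_mul, map_inv, αx _ hij, this])
  refine ⟨b, α, θ, h1, h2, h3, h4, h5, h6, fun i hi => h7 _ (hneI i hi).1 (hneI i hi).2,
    fun i y hi hy => h7 _ ?_ ?_⟩
  · rintro ⟨t, _ | z⟩ h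
    · simp [a] at h
    · simp only [a, Option.elim, Sum.inr.injEq, Sigma.mk.injEq] at h
      exact hi t h.1
  · rintro ⟨t, z⟩ h
    exact hy t z (Sum.inr_injective h)

lemma exists_involution_product (M : SoftModel φ N i₀) {T : Type*} [Finite T] [Nonempty T]
    (j k : T → I)
    (hj : Function.Injective j) (hjk : ∀ t t', k t ≠ j t') (hj₀ : ∀ t, j t ≠ i₀)
    (e : ∀ t, Option (N (j t)) → N (k t))
    (he : Function.Injective fun p : Σ t, Option (N (j t)) =>
      (⟨k p.1, e p.1 p.2⟩ : Σ i, N i)) :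
    ∃ α θ : MulAut F, θ = φ * (α * φ * α⁻¹) ∧ IsInvolution (toOut θ) ∧
      Nat.card (InvertedHom θ) = 3 ^ (Nat.card T + Nat.card T) := by
  obtain ⟨b, α, θ, h1, h2, h3, h4, h5, h6, h7, h8⟩ := M.exists_product j k hj hjk hj₀ e he
  refine ⟨α, θ, h1, ⟨?_, by rw [← map_pow, h2, map_one]⟩, ?_⟩
  · exact toOut_ne_one_of_inverts b _ ⟨1, by simpa using h3 (Classical.arbitrary T)⟩
  · rw [← Nat.card_sum]
    refine card_invertedHom b θ (Sum.elim (fun t => Sum.inl ⟨j t, hj₀ t⟩)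
      fun t => Sum.inr ⟨k t, e t none⟩) ?_ ?_ ?_
    · refine Function.Injective.sumElim (fun t t' h => hj (by simpa using h))
        (fun t t' h => ?_) (by simp)
      have := @he ⟨t, none⟩ ⟨t', none⟩ (by simpa using h)
      exact congrArg Sigma.fst this
    · rintro (t | t)
      · exact ⟨1, by simpa using h3 t⟩
      · exact ⟨1, by simpa using h5 t⟩
    · rintro (i | ⟨i, y⟩) hi
      · refine ⟨1, ?_⟩
        simpa using h7 i fun t h => hi (Sum.inl t) (by simp [← h])
      · by_cases hij : ∃ t, i = j t
        · obtain ⟨t, rfl⟩ := hij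
          exact ⟨_, h4 t y⟩
        push Not at hij
        by_cases hik : ∃ t z, (⟨i, y⟩ : Σ i, N i) = ⟨k t, e t z⟩
        · obtain ⟨t, _ | z, h⟩ := hik
          · exact absurd (congrArg Sum.inr h) (hi (Sum.inr t))
          · rw [h]
            exact ⟨_, h6 t z⟩
        · push Not at hik
          exact ⟨1, by simpa using h8 i y hij hik⟩

end SoftModel

end Model

section Square

lemma exists_fixedPointFree_involution (J : Type*) [Infinite J] :
    ∃ (m : J → J) (pos : J → Prop), (∀ i, m (m i) = i) ∧ ∀ i, pos (m i) ↔ ¬ pos i := by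
  have h : Cardinal.mk (J ⊕ J) = Cardinal.mk J := by
    rw [Cardinal.mk_sum, Cardinal.lift_id, Cardinal.add_eq_self (Cardinal.aleph0_le_mk J)]
  obtain ⟨E⟩ := Cardinal.eq.1 h
  refine ⟨fun i => E (E.symm i).swap, fun i => (E.symm i).isLeft, fun i => by simp, fun i => ?_⟩
  rcases h : E.symm i with t | t <;> simp [h]

variable {F : Type*} [Group F]

lemma SoftModel.exists_sq_eq {φ : MulAut F} {I : Type*} {N : I → Type*} {i₀ : I}
    (M : SoftModel φ N i₀) [Infinite I]
    (hN : ∀ i i', i ≠ i₀ → i' ≠ i₀ → Nonempty (N i ≃ N i')) : ∃ r : MulAut F, r ^ 2 = φ := by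
  classical
  have : Infinite {i // i ≠ i₀} := by
    have := (Set.finite_singleton i₀).infinite_compl
    exact this.to_subtype
  obtain ⟨m, pos, hm, hpos⟩ := exists_fixedPointFree_involution {i // i ≠ i₀}
  let q₀ : {i // i ≠ i₀} := Classical.arbitrary _
  have Q : ∀ i : {i // i ≠ i₀}, N i ≃ N q₀ := fun i => (hN i q₀ i.2 q₀.2).some
  let Y : {i // i ≠ i₀} → N q₀ → F := fun i q => M.basis (Sum.inr ⟨i, (Q i).symm q⟩)
  have hY : ∀ i q, φ (Y i q) = M.x i * Y i q * (M.x i)⁻¹ := fun i q => M.map_y _ _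
  let r : F →* F := M.basis.lift (Sum.elim
    (fun i => if pos i then M.x (m i) else (M.x (m i))⁻¹)
    fun p => if h : p.1 = i₀ then M.basis (Sum.inr p) else
      if pos ⟨p.1, h⟩ then Y (m ⟨p.1, h⟩) (Q ⟨p.1, h⟩ p.2) else
        M.x (m ⟨p.1, h⟩) * Y (m ⟨p.1, h⟩) (Q ⟨p.1, h⟩ p.2) * (M.x (m ⟨p.1, h⟩))⁻¹)
  have rx : ∀ i : {i // i ≠ i₀}, r (M.x i) = if pos i then M.x (m i) else (M.x (m i))⁻¹ := by
    intro i
    rw [← M.basis_inl i, FreeGroupBasis.lift_coe, Sum.elim_inl]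
  have rU : ∀ u, r (M.basis (Sum.inr ⟨i₀, u⟩)) = M.basis (Sum.inr ⟨i₀, u⟩) := by
    intro u
    rw [FreeGroupBasis.lift_coe, Sum.elim_inr, dif_pos rfl]
  have rY : ∀ i q, r (Y i q) = if pos i then Y (m i) q else
      M.x (m i) * Y (m i) q * (M.x (m i))⁻¹ := by
    intro i q
    rw [FreeGroupBasis.lift_coe, Sum.elim_inr, dif_neg i.2]
    simp only [Subtype.coe_eta, Equiv.apply_symm_apply]
  have hr : r.comp r = φ.toMonoidHom := by
    refine M.basis.ext_hom _ _ ?_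
    rintro (i | ⟨i, y⟩)
    · rw [M.basis_inl]
      change r (r (M.x i)) = φ (M.x i)
      rw [M.map_x, rx]
      by_cases h : pos i
      · rw [if_pos h, rx, if_neg (by rw [hpos]; exact not_not.2 h), hm]
      · rw [if_neg h, map_inv, rx, if_pos ((hpos i).2 h), hm]
    · change r (r _) = φ _
      by_cases hi : i = i₀
      · subst hi
        rw [rU, rU, M.map_y, M.x_base]
        simp
      · obtain ⟨q, rfl⟩ := (Q ⟨i, hi⟩).symm.surjective y
        change r (r (Y ⟨i, hi⟩ q)) = φ (Y ⟨i, hi⟩ q)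
        rw [hY, rY]
        by_cases h : pos ⟨i, hi⟩
        · rw [if_pos h, rY, if_neg (by rw [hpos]; exact not_not.2 h), hm]
        · rw [if_neg h]
          simp only [map_mul, map_inv, rx, rY, if_pos ((hpos ⟨i, hi⟩).2 h), hm]
  have hr' : ∀ a, r (r a) = φ a := fun a => DFunLike.congr_fun hr a
  have hbij : Function.Bijective r := by
    constructor
    · intro a a' h
      apply φ.injective
      rw [← hr', ← hr', h]
    · intro a
      exact ⟨r (φ.symm a), by rw [hr', MulEquiv.apply_symm_apply]⟩
  refine ⟨MulEquiv.ofBijective r hbij, ?_⟩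
  ext a
  rw [pow_two, MulAut.mul_apply]
  exact hr' a

end Square

section Combinatorics

universe u

lemma exists_four_or_forall_eq {I C : Type*} [Infinite I] (c : I → C) :
    (∃ i₀, ∀ i i', i ≠ i₀ → i' ≠ i₀ → c i = c i') ∨
      ∃ i j k l, i ≠ l ∧ k ≠ j ∧ j ≠ l ∧ i ≠ k ∧ c i ≠ c j ∧ c k ≠ c l := by
  classical
  by_contra! hcon
  obtain ⟨h1, h2⟩ := hcon
  obtain ⟨i, j, -, -, hij⟩ := h1 (Classical.arbitrary I)
  obtain ⟨k, hk⟩ := Infinite.exists_notMem_finset ({i, j} : Finset I)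
  obtain ⟨l, hl⟩ := Infinite.exists_notMem_finset ({i, j, k} : Finset I)
  simp only [Finset.mem_insert, Finset.mem_singleton, not_or] at hk hl
  have hrest : ∀ m n, m ≠ i → m ≠ j → n ≠ i → n ≠ j → c m = c n := by
    intro m n hm1 hm2 hn1 hn2
    exact h2 i j m n (Ne.symm hn1) hm2 (Ne.symm hn2) (Ne.symm hm1) hij
  have hor : c i = c k ∨ c j = c k := by
    by_contra! h
    refine h.2 ?_
    rw [hrest k l hk.1 hk.2 hl.1 hl.2.1]
    exact h2 i k j l (Ne.symm hl.1) (Ne.symm hk.2) (Ne.symm hl.2.2)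
      (fun h => hij (by rw [h])) h.1
  rcases hor with h | h
  · obtain ⟨m, n, hm, hn, hmn⟩ := h1 j
    have : ∀ m, m ≠ j → c m = c k := by
      intro m hm
      by_cases hmi : m = i
      · rw [hmi, h]
      · exact hrest m k hmi hm hk.1 hk.2
    exact hmn (by rw [this m hm, this n hn])
  · obtain ⟨m, n, hm, hn, hmn⟩ := h1 i
    have : ∀ m, m ≠ i → c m = c k := by
      intro m hm
      by_cases hmj : m = j
      · rw [hmj, h]
      · exact hrest m k hm hmj hk.1 hk.2
    exact hmn (by rw [this m hm, this n hn])

lemma nonempty_option_embedding_of_mk_lt {A B : Type u}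
    (h : Cardinal.mk A < Cardinal.mk B) : Nonempty (Option A ↪ B) := by
  rw [← Cardinal.le_def, Cardinal.mk_option]
  exact Cardinal.add_one_le_of_lt h

/-- Two blocks `N (j t)` that embed, together with one more point each, disjointly into other
parts `N (k t)`. -/
def HasTwoBlockCopies {I : Type*} (N : I → Type*) : Prop :=
  ∃ (j k : Bool → I) (e : ∀ t, Option (N (j t)) → N (k t)), Function.Injective j ∧
    (∀ t t', k t ≠ j t') ∧ Function.Injective fun p : Σ t, Option (N (j t)) =>
      (⟨k p.1, e p.1 p.2⟩ : Σ i, N i)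

lemma hasTwoBlockCopies_of_lt {I : Type*} {N : I → Type u} {i j k l : I}
    (hil : i ≠ l) (hkj : k ≠ j) (hjl : j ≠ l) (hik : i ≠ k)
    (hij : Cardinal.mk (N j) < Cardinal.mk (N i)) (hkl : Cardinal.mk (N l) < Cardinal.mk (N k)) :
    HasTwoBlockCopies N := by
  obtain ⟨e₁⟩ := nonempty_option_embedding_of_mk_lt hij
  obtain ⟨e₂⟩ := nonempty_option_embedding_of_mk_lt hkl
  refine ⟨fun t => bif t then j else l, fun t => bif t then i else k,
    fun t => match t with
      | true => e₁
      | false => e₂, ?_, ?_, ?_⟩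
  · rintro (_ | _) (_ | _) h
    · rfl
    · exact absurd h hjl.symm
    · exact absurd h hjl
    · rfl
  · rintro (_ | _) (_ | _)
    · exact fun h => hkl.ne (by rw [show k = l from h])
    · exact hkj
    · exact hil
    · exact fun h => hij.ne (by rw [show i = j from h])
  · rintro ⟨_ | _, z⟩ ⟨_ | _, z'⟩ h
    · simp only [Sigma.mk.injEq] at h
      have := e₂.injective (eq_of_heq h.2)
      rw [this]
    · exact absurd (congrArg Sigma.fst h) hik.symm
    · exact absurd (congrArg Sigma.fst h) hik
    · simp only [Sigma.mk.injEq] at h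
      have := e₁.injective (eq_of_heq h.2)
      rw [this]

lemma hasTwoBlockCopies_of_infinite {I : Type*} {N : I → Type u} {i j l : I}
    (hij : i ≠ j) (hil : i ≠ l) (hjl : j ≠ l) [Infinite (N i)]
    (hj : Cardinal.mk (N j) ≤ Cardinal.mk (N i)) (hl : Cardinal.mk (N l) ≤ Cardinal.mk (N i)) :
    HasTwoBlockCopies N := by
  have hle : Cardinal.mk (Option (N j) ⊕ Option (N l)) ≤ Cardinal.mk (N i) := by
    have h0 := Cardinal.aleph0_le_mk (N i)
    have h1 : (1 : Cardinal) ≤ Cardinal.mk (N i) := Cardinal.one_le_aleph0.trans h0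
    simp only [Cardinal.mk_sum, Cardinal.mk_option, Cardinal.lift_id]
    exact Cardinal.add_le_of_le h0 (Cardinal.add_le_of_le h0 hj h1)
      (Cardinal.add_le_of_le h0 hl h1)
  obtain ⟨e⟩ := (Cardinal.le_def _ _).1 hle
  refine ⟨fun t => bif t then j else l, fun _ => i,
    fun t => match t with
      | true => fun z => e (Sum.inl z)
      | false => fun z => e (Sum.inr z), ?_, ?_, ?_⟩
  · rintro (_ | _) (_ | _) h
    · rfl
    · exact absurd h hjl.symm
    · exact absurd h hjl
    · rfl
  · rintro _ (_ | _)
    · exact hil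
    · exact hij
  · rintro ⟨_ | _, z⟩ ⟨_ | _, z'⟩ h
    all_goals
      have h' := e.injective (eq_of_heq (Sigma.mk.inj h).2)
      simp only [Sum.inl.injEq, Sum.inr.injEq, reduceCtorEq] at h'
    · rw [h']
    · rw [h']

lemma hasTwoBlockCopies_or {I : Type*} {N : I → Type u} {i j l : I}
    (hij : i ≠ j) (hil : i ≠ l) (hjl : j ≠ l) (hinf : Infinite I ∨ ∃ i, Infinite (N i)) :
    HasTwoBlockCopies N ∨
      Infinite I ∧ ∃ i₀, ∀ i i', i ≠ i₀ → i' ≠ i₀ → Nonempty (N i ≃ N i') := by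
  classical
  rcases finite_or_infinite I with hI | hI
  · left
    obtain ⟨m, hm⟩ : ∃ i, Infinite (N i) := hinf.resolve_left (not_infinite_iff_finite.2 hI)
    have : Nonempty I := ⟨i⟩
    obtain ⟨i₀, hi₀⟩ := Finite.exists_max fun i => Cardinal.mk (N i)
    have : Infinite (N i₀) := by
      rw [Cardinal.infinite_iff] at hm ⊢
      exact hm.trans (hi₀ m)
    obtain ⟨p, q, hp, hq, hpq⟩ : ∃ p q, i₀ ≠ p ∧ i₀ ≠ q ∧ p ≠ q := by
      by_cases h1 : i₀ = i
      · exact ⟨j, l, by rwa [h1], by rwa [h1], hjl⟩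
      by_cases h2 : i₀ = j
      · exact ⟨i, l, h1, by rwa [h2], hil⟩
      · exact ⟨i, j, h1, h2, hij⟩
    exact hasTwoBlockCopies_of_infinite hp hq hpq (hi₀ p) (hi₀ q)
  · rcases exists_four_or_forall_eq fun i => Cardinal.mk (N i) with ⟨i₀, h⟩ |
      ⟨i, j, k, l, hil, hkj, hjl, hik, h1, h2⟩
    · exact Or.inr ⟨hI, i₀, fun i i' hi hi' => Cardinal.eq.1 (h i i' hi hi')⟩
    · left
      rcases h1.lt_or_gt with h1 | h1 <;> rcases h2.lt_or_gt with h2 | h2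
      · exact hasTwoBlockCopies_of_lt hkj.symm hil.symm hik hjl h1 h2
      · exact hasTwoBlockCopies_of_lt hjl hik.symm hil hkj.symm h1 h2
      · exact hasTwoBlockCopies_of_lt hik hjl.symm hkj.symm hil h1 h2
      · exact hasTwoBlockCopies_of_lt hil hkj hjl hik h1 h2

end Combinatorics

section ManyBlocks

variable {F : Type*} [Group F]

lemma toOut_mul_conj_mem {φ α θ : MulAut F} (h : θ = φ * (α * φ * α⁻¹)) :
    toOut θ ∈ {g | IsConj (toOut φ) g} * {g | IsConj (toOut φ) g} := by
  refine Set.mem_mul.2 ⟨toOut φ, IsConj.refl _, toOut (α * φ * α⁻¹), ?_, by rw [h]; exact (map_mul _ _ _).symm⟩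
  exact isConj_iff.2 ⟨toOut α, by simp⟩

lemma StarCondition.isConj {G : Type*} [Group G] {K : Set G} (h : StarCondition K) {c d : G}
    (hc : c ∈ K * K) (hd : d ∈ K * K) (hci : IsInvolution c) (hdi : IsInvolution d) :
    IsConj c d := by
  obtain ⟨⟨a, -, -, ha⟩, -⟩ := h
  exact (ha c hc hci).symm.trans (ha d hd hdi)

lemma SoftModel.not_starCondition_of_hasTwoBlockCopies {φ : MulAut F} {I : Type*}
    {N : I → Type*} {i₀ : I} (M : SoftModel φ N i₀) (hN : HasTwoBlockCopies N) :
    ¬ StarCondition {g | IsConj (toOut φ) g} := by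
  intro hstar
  obtain ⟨j, k, e, hj, hjk, he⟩ := hN
  obtain ⟨M'⟩ := M.baseChange (k true)
  have hφ : toOut (MulAut.conj (M.x (k true))⁻¹ * φ) = toOut φ := toOut_conj_mul _ _
  rw [← hφ] at hstar
  obtain ⟨α, θ, h1, h2, h3⟩ := M'.exists_involution_product j k hj hjk
    (fun t => (hjk true t).symm) e he
  obtain ⟨α', θ', h1', h2', h3'⟩ := M'.exists_involution_product (T := Unit)
    (fun _ => j true) (fun _ => k true) (Function.injective_of_subsingleton _)
    (fun _ _ => hjk true true) (fun t => (hjk true true).symm) (fun _ => e true)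
    (by
      rintro ⟨⟨⟩, z⟩ ⟨⟨⟩, z'⟩ h
      have := @he ⟨true, z⟩ ⟨true, z'⟩ h
      simp only [Sigma.mk.injEq, heq_eq_eq, true_and] at this
      rw [this])
  have := card_invertedHom_eq_of_isConj
    (hstar.isConj (toOut_mul_conj_mem h1) (toOut_mul_conj_mem h1') h2 h2')
  rw [h3, h3'] at this
  simp at this

lemma SoftModel.not_starCondition_of_three {φ : MulAut F} {I : Type*} {N : I → Type*} {i₀ : I}
    (M : SoftModel φ N i₀) {i j l : I} (hij : i ≠ j) (hil : i ≠ l) (hjl : j ≠ l)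
    (hinf : Infinite I ∨ ∃ i, Infinite (N i)) :
    ¬ StarCondition {g | IsConj (toOut φ) g} := by
  rcases hasTwoBlockCopies_or hij hil hjl hinf with h | ⟨_, i₁, h⟩
  · exact M.not_starCondition_of_hasTwoBlockCopies h
  · intro hstar
    obtain ⟨M'⟩ := M.baseChange i₁
    obtain ⟨r, hr⟩ := M'.exists_sq_eq h
    exact hstar.2 (toOut φ) (IsConj.refl _) ⟨toOut r, by rw [← map_pow, hr, toOut_conj_mul]⟩

end ManyBlocks

section ModTwo

/-- The Heisenberg group over the field with two elements. -/
@[ext]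
structure HeisenbergTwo where
  /-- first abelian coordinate -/
  p : ZMod 2
  /-- second abelian coordinate -/
  q : ZMod 2
  /-- central coordinate -/
  c : ZMod 2

namespace HeisenbergTwo

instance : Mul HeisenbergTwo := ⟨fun u v => ⟨u.p + v.p, u.q + v.q, u.c + v.c + u.p * v.q⟩⟩

instance : One HeisenbergTwo := ⟨⟨0, 0, 0⟩⟩

instance : Inv HeisenbergTwo := ⟨fun u => ⟨-u.p, -u.q, -u.c + u.p * u.q⟩⟩

lemma mul_def (u v : HeisenbergTwo) :
    u * v = ⟨u.p + v.p, u.q + v.q, u.c + v.c + u.p * v.q⟩ := rfl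

lemma one_def : (1 : HeisenbergTwo) = ⟨0, 0, 0⟩ := rfl

lemma inv_def (u : HeisenbergTwo) : u⁻¹ = ⟨-u.p, -u.q, -u.c + u.p * u.q⟩ := rfl

instance : Group HeisenbergTwo :=
  Group.ofLeftAxioms
    (fun u v w => by ext <;> simp only [mul_def] <;> ring)
    (fun u => by ext <;> simp [mul_def, one_def])
    (fun u => by ext <;> simp only [mul_def, one_def, inv_def] <;> ring)

end HeisenbergTwo

variable {F : Type*} [Group F]

open Multiplicative (toAdd ofAdd)

/-- Two elements with the same image in the abelianization modulo two. -/
def ModTwoEq (a a' : F) : Prop :=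
  ∀ h : F →* Multiplicative (ZMod 2), h a = h a'

/-- The cup product of two homomorphisms to the group of order two gives a relation between any
`g` and `a` with `g * θ a = a * g`, provided `θ` inverts or conjugates the elements of a basis. -/
lemma cup_eq_of_twisted_fixed {ι : Type*} (b : FreeGroupBasis ι F) {θ : MulAut F}
    (α β γ : F →* Multiplicative (ZMod 2))
    (h : ∀ i, (θ (b i) = (b i)⁻¹ ∧ toAdd (γ (b i)) = toAdd (α (b i)) * toAdd (β (b i))) ∨
      ∃ z, θ (b i) = z * b i * z⁻¹ ∧ toAdd (γ (b i)) =
        toAdd (α z) * toAdd (β (b i)) + toAdd (α (b i)) * toAdd (β z))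
    {g a : F} (hga : g * θ a = a * g) :
    toAdd (γ a) = toAdd (α a) * toAdd (β g) + toAdd (α g) * toAdd (β a) := by
  let η : F →* HeisenbergTwo := b.lift fun i => ⟨toAdd (α (b i)), toAdd (β (b i)), 0⟩
  let πp : HeisenbergTwo →* Multiplicative (ZMod 2) :=
    ⟨⟨fun u => ofAdd u.p, rfl⟩, fun _ _ => rfl⟩
  let πq : HeisenbergTwo →* Multiplicative (ZMod 2) :=
    ⟨⟨fun u => ofAdd u.q, rfl⟩, fun _ _ => rfl⟩
  have hη : ∀ i, η (b i) = ⟨toAdd (α (b i)), toAdd (β (b i)), 0⟩ := fun i => b.lift_coe _ i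
  have hp : ∀ a, (η a).p = toAdd (α a) := by
    have : πp.comp η = α := b.ext_hom _ _ fun i => by
      rw [MonoidHom.comp_apply, hη]; rfl
    exact fun a => congrArg toAdd (DFunLike.congr_fun this a)
  have hq : ∀ a, (η a).q = toAdd (β a) := by
    have : πq.comp η = β := b.ext_hom _ _ fun i => by
      rw [MonoidHom.comp_apply, hη]; rfl
    exact fun a => congrArg toAdd (DFunLike.congr_fun this a)
  let κ : F →* HeisenbergTwo :=
    ⟨⟨fun a => η a * ⟨0, 0, toAdd (γ a)⟩, by
      ext <;> simp [HeisenbergTwo.mul_def, HeisenbergTwo.one_def]⟩, fun a a' => by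
      ext <;> simp [HeisenbergTwo.mul_def]; ring⟩
  have h2 : ∀ u : ZMod 2, -u = u := by decide
  have hκ : η.comp θ.toMonoidHom = κ := by
    refine b.ext_hom _ _ fun i => ?_
    change η (θ (b i)) = η (b i) * ⟨0, 0, toAdd (γ (b i))⟩
    rcases h i with ⟨h, h'⟩ | ⟨z, h, h'⟩
    · rw [h, h', map_inv, hη]
      ext <;> simp [HeisenbergTwo.mul_def, HeisenbergTwo.inv_def, h2]
    · rw [h, h', map_mul, map_mul, map_inv]
      ext
      · simp only [HeisenbergTwo.mul_def, HeisenbergTwo.inv_def]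
        ring
      · simp only [HeisenbergTwo.mul_def, HeisenbergTwo.inv_def]
        ring
      · simp only [HeisenbergTwo.mul_def, HeisenbergTwo.inv_def, hp, hq, h2]
        generalize toAdd (α z) = r, toAdd (β z) = s, toAdd (α (b i)) = t, toAdd (β (b i)) = w,
          (η z).c = m, (η (b i)).c = n
        revert r s t w m n
        decide
  have hθa : η (θ a) = η a * ⟨0, 0, toAdd (γ a)⟩ := DFunLike.congr_fun hκ a
  have key := congrArg (fun u => (η u).c) hga
  simp only [map_mul, hθa] at key
  simp only [HeisenbergTwo.mul_def, hp, hq] at key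
  generalize toAdd (α a) = r, toAdd (β a) = s, toAdd (α g) = t, toAdd (β g) = w,
    (η a).c = m, (η g).c = n, toAdd (γ a) = l at key ⊢
  revert r s t w m n l
  decide

open Classical in
/-- The coordinates modulo two with respect to a basis. -/
noncomputable def FreeGroupBasis.coordTwo {ι : Type*} (b : FreeGroupBasis ι F) (i : ι) :
    F →* Multiplicative (ZMod 2) :=
  b.lift fun j => ofAdd (if j = i then 1 else 0)

lemma FreeGroupBasis.coordTwo_self {ι : Type*} (b : FreeGroupBasis ι F) (i : ι) :
    toAdd (b.coordTwo i (b i)) = 1 := by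
  rw [FreeGroupBasis.coordTwo, b.lift_coe, if_pos rfl]; rfl

lemma FreeGroupBasis.coordTwo_of_ne {ι : Type*} (b : FreeGroupBasis ι F) {i j : ι} (h : j ≠ i) :
    toAdd (b.coordTwo i (b j)) = 0 := by
  rw [FreeGroupBasis.coordTwo, b.lift_coe, if_neg h]; rfl

lemma FreeGroupBasis.modTwoEq_of_coordTwo {ι : Type*} (b : FreeGroupBasis ι F) {a a' : F}
    (h : ∀ i, toAdd (b.coordTwo i a) = toAdd (b.coordTwo i a')) : ModTwoEq a a' := by
  classical
  intro f
  let η : F →* Multiplicative (ι →₀ ZMod 2) := b.lift fun i => ofAdd (Finsupp.single i 1)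
  have hη : ∀ a i, (toAdd (η a)) i = toAdd (b.coordTwo i a) := by
    intro a i
    have : (AddMonoidHom.toMultiplicative (Finsupp.applyAddHom i)).comp η = b.coordTwo i := by
      refine b.ext_hom _ _ fun j => ?_
      rw [MonoidHom.comp_apply, b.lift_coe, FreeGroupBasis.coordTwo, b.lift_coe]
      change ofAdd ((Finsupp.single j (1 : ZMod 2)) i) = _
      rw [Finsupp.single_apply]
    exact congrArg toAdd (DFunLike.congr_fun this a)
  have hf : ∃ k : Multiplicative (ι →₀ ZMod 2) →* Multiplicative (ZMod 2), k.comp η = f := by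
    refine ⟨AddMonoidHom.toMultiplicative
      (Finsupp.linearCombination (ZMod 2) fun i => toAdd (f (b i))).toAddMonoidHom,
      b.ext_hom _ _ fun j => ?_⟩
    rw [MonoidHom.comp_apply, b.lift_coe]
    change ofAdd (Finsupp.linearCombination (ZMod 2) (fun i => toAdd (f (b i)))
      (Finsupp.single j 1)) = _
    rw [Finsupp.linearCombination_single, one_smul]
    rfl
  obtain ⟨k, rfl⟩ := hf
  have : η a = η a' := by
    apply toAdd.injective
    ext i
    rw [hη, hη, h]
  rw [MonoidHom.comp_apply, MonoidHom.comp_apply, this]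

/-- There are three twists `a ↦ g * θ a * g⁻¹` of `θ`, different modulo two, whose fixed subgroups
have rank at least two modulo two. -/
def HasThreeFixedParts (θ : MulAut F) : Prop :=
  ∃ g : Fin 3 → F, (∀ i j, i ≠ j → ¬ ModTwoEq (g i) (g j)) ∧
    ∀ i, ∃ a a', g i * θ a = a * g i ∧ g i * θ a' = a' * g i ∧
      ¬ ModTwoEq a 1 ∧ ¬ ModTwoEq a' 1 ∧ ¬ ModTwoEq a a'

lemma ModTwoEq.of_map_mul {χ : MulAut F} {u v g : F} (h : ModTwoEq (χ u * g) (χ v * g)) :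
    ModTwoEq u v := by
  intro f
  simpa using h (f.comp (χ⁻¹).toMonoidHom)

lemma HasThreeFixedParts.of_isConj {θ ψ : MulAut F} (hθ : HasThreeFixedParts θ)
    (h : IsConj (toOut θ) (toOut ψ)) : HasThreeFixedParts ψ := by
  obtain ⟨χ, c, rfl⟩ := exists_conj_of_isConj_toOut h
  obtain ⟨g, hg, hfix⟩ := hθ
  have hmap : ∀ {u v}, ModTwoEq (χ u) (χ v) → ModTwoEq u v := fun {u v} h =>
    ModTwoEq.of_map_mul (g := 1) (by simpa using h)
  have htw : ∀ {u a : F}, u * θ a = a * u → χ u * c⁻¹ *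
      (MulAut.conj c * (χ * θ * χ⁻¹)) (χ a) = χ a * (χ u * c⁻¹) := by
    intro u a h
    have := congrArg χ h
    rw [map_mul, map_mul] at this
    simp [← mul_assoc, ← this]
  refine ⟨fun i => χ (g i) * c⁻¹, fun i j hij h => hg i j hij h.of_map_mul, fun i => ?_⟩
  obtain ⟨a, a', h1, h2, h3, h4, h5⟩ := hfix i
  exact ⟨χ a, χ a', htw h1, htw h2, fun h => h3 (hmap (by simpa using h)),
    fun h => h4 (hmap (by simpa using h)), fun h => h5 (hmap h)⟩

/-- If `θ` is a soft involution with two blocks and without fixed part, then the twists of `θ`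
fixing a subgroup of rank two modulo two are given modulo two by the inverted elements. -/
lemma exists_modTwoEq_of_twisted_fixed {ι : Type*} (b : FreeGroupBasis ι F) {θ : MulAut F}
    (t : Bool → ι) (p : ι → Bool) (hp : ∀ k, p (t k) = k)
    (htop : ∀ k, θ (b (t k)) = (b (t k))⁻¹)
    (hblock : ∀ i, (∀ k, i ≠ t k) →
      ∃ z, (z = b (t (p i)) ∨ z = (b (t (p i)))⁻¹) ∧ θ (b i) = z * b i * z⁻¹)
    {g a a' : F} (ha : g * θ a = a * g) (ha' : g * θ a' = a' * g) (h1 : ¬ ModTwoEq a 1)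
    (h1' : ¬ ModTwoEq a' 1) (haa' : ¬ ModTwoEq a a') : ∃ k, ModTwoEq g (b (t k)) := by
  have ht : ∀ {k k'}, k ≠ k' → t k ≠ t k' := fun {k k'} h h' =>
    h (by rw [← hp k, h', hp])
  have htop' : ∀ i, (∃ k, i = t k) ∨ ∀ k, i ≠ t k := fun i => by
    by_cases h : ∃ k, i = t k
    · exact Or.inl h
    · exact Or.inr (not_exists.1 h)
  have hidem : ∀ u : ZMod 2, u = u * u := by decide
  have hadd : ∀ u : ZMod 2, u + u = 0 := by decide
  have hneg : ∀ u : ZMod 2, -u = u := by decide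
  have hone : ∀ u : ZMod 2, u ≠ 0 → u = 1 := by decide
  let G : ι → ZMod 2 := fun i => toAdd (b.coordTwo i g)
  have hz : ∀ {z : F} {i}, (z = b (t (p i)) ∨ z = (b (t (p i)))⁻¹) → ∀ l,
      toAdd (b.coordTwo l z) = toAdd (b.coordTwo l (b (t (p i)))) := by
    rintro z i (rfl | rfl) l
    · rfl
    · rw [map_inv, toAdd_inv, hneg]
  have hE : ∀ {a}, g * θ a = a * g → ∀ k, toAdd (b.coordTwo (t k) a) = 0 := by
    intro a ha k
    have := cup_eq_of_twisted_fixed b (b.coordTwo (t k)) (b.coordTwo (t k)) (b.coordTwo (t k))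
      (fun i => ?_) ha
    · rw [this, mul_comm, hadd]
    · rcases htop' i with ⟨k', rfl⟩ | hi
      · exact Or.inl ⟨htop k', hidem _⟩
      · obtain ⟨z, -, hz'⟩ := hblock i hi
        exact Or.inr ⟨z, hz', by simp only [b.coordTwo_of_ne (hi k), mul_zero, zero_mul, add_zero]⟩
  have hA : ∀ {a}, g * θ a = a * g → ∀ j, (∀ k, j ≠ t k) →
      toAdd (b.coordTwo j a) = G (t (p j)) * toAdd (b.coordTwo j a) := by
    intro a ha j hj
    have := cup_eq_of_twisted_fixed b (b.coordTwo (t (p j))) (b.coordTwo j) (b.coordTwo j)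
      (fun i => ?_) ha
    · rwa [hE ha, zero_mul, zero_add] at this
    · rcases htop' i with ⟨k', rfl⟩ | hi
      · exact Or.inl ⟨htop k', by simp only [b.coordTwo_of_ne (hj k').symm, mul_zero]⟩
      · obtain ⟨z, hz1, hz'⟩ := hblock i hi
        refine Or.inr ⟨z, hz', ?_⟩
        rw [b.coordTwo_of_ne (hi _), zero_mul, add_zero, hz hz1]
        by_cases hij : i = j
        · rw [hij, b.coordTwo_self, b.coordTwo_self, mul_one]
        · rw [b.coordTwo_of_ne hij, mul_zero]
  have hC : ∀ {a}, g * θ a = a * g → ∀ j k, (∀ k, j ≠ t k) → k ≠ p j →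
      0 = G (t k) * toAdd (b.coordTwo j a) := by
    intro a ha j k hj hjk
    have := cup_eq_of_twisted_fixed b (b.coordTwo (t k)) (b.coordTwo j) 1 (fun i => ?_) ha
    · rwa [hE ha, zero_mul, zero_add] at this
    · rcases htop' i with ⟨k', rfl⟩ | hi
      · exact Or.inl ⟨htop k', by simp only [b.coordTwo_of_ne (hj k').symm, mul_zero]; rfl⟩
      · obtain ⟨z, hz1, hz'⟩ := hblock i hi
        refine Or.inr ⟨z, hz', ?_⟩
        rw [b.coordTwo_of_ne (hi _), zero_mul, add_zero, hz hz1]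
        by_cases hij : i = j
        · rw [hij, b.coordTwo_of_ne (ht hjk.symm), zero_mul]; rfl
        · rw [b.coordTwo_of_ne hij, mul_zero]; rfl
  have hD : ∀ {a}, g * θ a = a * g → ∀ i j, (∀ k, i ≠ t k) → (∀ k, j ≠ t k) →
      0 = toAdd (b.coordTwo i a) * G j + G i * toAdd (b.coordTwo j a) := by
    intro a ha i j hi hj
    by_cases hij : i = j
    · rw [hij, mul_comm, hadd]
    refine cup_eq_of_twisted_fixed b (b.coordTwo i) (b.coordTwo j) 1 (fun m => ?_) ha
    rcases htop' m with ⟨k', rfl⟩ | hm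
    · exact Or.inl ⟨htop k', by simp only [b.coordTwo_of_ne (hj k').symm, mul_zero]; rfl⟩
    · obtain ⟨z, hz1, hz'⟩ := hblock m hm
      refine Or.inr ⟨z, hz', ?_⟩
      rw [hz hz1, hz hz1, b.coordTwo_of_ne (hi _).symm, b.coordTwo_of_ne (hj _).symm, zero_mul,
        mul_zero, add_zero]
      rfl
  have hne : ∀ {a}, ¬ ModTwoEq a 1 → ∃ j, toAdd (b.coordTwo j a) ≠ 0 := by
    intro a h
    by_contra! h'
    exact h (b.modTwoEq_of_coordTwo fun i => by rw [h', map_one]; rfl)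
  obtain ⟨j, hj⟩ := hne h1
  have hjt : ∀ k, j ≠ t k := fun k h => hj (by rw [h, hE ha])
  refine ⟨p j, b.modTwoEq_of_coordTwo fun i => ?_⟩
  rcases htop' i with ⟨k, rfl⟩ | hi
  · by_cases hk : k = p j
    · have := hA ha j hjt
      rw [hone _ hj, mul_one] at this
      rw [hk, b.coordTwo_self]
      exact this.symm
    · have := hC ha j k hjt hk
      rw [hone _ hj, mul_one] at this
      rw [b.coordTwo_of_ne (ht (Ne.symm hk))]
      exact this.symm
  · rw [b.coordTwo_of_ne (hi _).symm]
    by_contra hGi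
    have hcoord : ∀ {a}, g * θ a = a * g → ¬ ModTwoEq a 1 → ∀ l, (∀ k, l ≠ t k) →
        toAdd (b.coordTwo l a) = G l := by
      intro a ha h1
      have hl : ∀ l, (∀ k, l ≠ t k) →
          toAdd (b.coordTwo l a) = G l * toAdd (b.coordTwo i a) := by
        intro l hl
        have := hD ha l i hl hi
        rw [show G i = 1 from hone _ hGi, mul_one] at this
        rw [eq_comm, ← hneg (G l * _)]
        exact (eq_neg_of_add_eq_zero_left this.symm).symm
      obtain ⟨m, hm⟩ := hne h1
      have hmt : ∀ k, m ≠ t k := fun k h => hm (by rw [h, hE ha])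
      have hi1 : toAdd (b.coordTwo i a) = 1 := hone _ fun h => hm (by rw [hl m hmt, h, mul_zero])
      intro l hlt
      rw [hl l hlt, hi1, mul_one]
    refine haa' (b.modTwoEq_of_coordTwo fun l => ?_)
    rcases htop' l with ⟨k, rfl⟩ | hl
    · rw [hE ha, hE ha']
    · rw [hcoord ha h1 l hl, hcoord ha' h1' l hl]

lemma not_hasThreeFixedParts {ι : Type*} (b : FreeGroupBasis ι F) {θ : MulAut F}
    (t : Bool → ι) (p : ι → Bool) (hp : ∀ k, p (t k) = k)
    (htop : ∀ k, θ (b (t k)) = (b (t k))⁻¹)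
    (hblock : ∀ i, (∀ k, i ≠ t k) →
      ∃ z, (z = b (t (p i)) ∨ z = (b (t (p i)))⁻¹) ∧ θ (b i) = z * b i * z⁻¹) :
    ¬ HasThreeFixedParts θ := by
  rintro ⟨g, hg, hfix⟩
  have : ∀ i, ∃ k, ModTwoEq (g i) (b (t k)) := fun i => by
    obtain ⟨a, a', h1, h2, h3, h4, h5⟩ := hfix i
    exact exists_modTwoEq_of_twisted_fixed b t p hp htop hblock h1 h2 h3 h4 h5
  choose k hk using this
  obtain ⟨i, j, hij, h⟩ := Fintype.exists_ne_map_eq_of_card_lt k (by simp)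
  exact hg i j hij fun f => by rw [hk i f, hk j f, h]

end ModTwo

section OneBlock

variable {F : Type*} [Group F]

lemma nonempty_option_equiv (Y : Type*) [Infinite Y] : Nonempty (Option Y ≃ Y) :=
  Cardinal.eq.1 (by rw [Cardinal.mk_option, Cardinal.add_one_eq (Cardinal.aleph0_le_mk Y)])

lemma FreeGroupBasis.not_modTwoEq_one {ι : Type*} (b : FreeGroupBasis ι F) (i : ι) :
    ¬ ModTwoEq (b i) 1 := by
  intro h
  have h1 := b.coordTwo_self i
  rw [h (b.coordTwo i), map_one] at h1
  exact zero_ne_one h1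

lemma FreeGroupBasis.not_modTwoEq {ι : Type*} (b : FreeGroupBasis ι F) {i j : ι} (hij : i ≠ j) :
    ¬ ModTwoEq (b i) (b j) := by
  intro h
  have h1 := b.coordTwo_self i
  rw [h (b.coordTwo i), b.coordTwo_of_ne hij.symm] at h1
  exact zero_ne_one h1

lemma ModTwoEq.symm {a a' : F} (h : ModTwoEq a a') : ModTwoEq a' a := fun f => (h f).symm

lemma ModTwoEq.inv {a a' : F} (h : ModTwoEq a⁻¹ a'⁻¹) : ModTwoEq a a' := fun f =>
  inv_injective (by simpa only [map_inv] using h f)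

lemma hasThreeFixedParts_of_basis {ι : Type*} (b : FreeGroupBasis ι F) {θ : MulAut F}
    {x x' u u' y y' z z' : ι} (hx : x ≠ x') (hu : u ≠ u') (hy : y ≠ y') (hz : z ≠ z')
    (hθu : θ (b u) = b u) (hθu' : θ (b u') = b u')
    (hθy : θ (b y) = b x * b y * (b x)⁻¹) (hθy' : θ (b y') = b x * b y' * (b x)⁻¹)
    (hθz : θ (b z) = b x' * b z * (b x')⁻¹) (hθz' : θ (b z') = b x' * b z' * (b x')⁻¹) :
    HasThreeFixedParts θ := by
  have h1 : ∀ i, ¬ ModTwoEq 1 (b i)⁻¹ := fun i h =>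
    b.not_modTwoEq_one i (ModTwoEq.inv (by simpa using h.symm))
  have h2 : ¬ ModTwoEq (b x)⁻¹ (b x')⁻¹ := fun h => b.not_modTwoEq hx h.inv
  refine ⟨![1, (b x)⁻¹, (b x')⁻¹], ?_, ?_⟩
  · intro i j hij
    fin_cases i <;> fin_cases j
    · exact absurd rfl hij
    · exact h1 x
    · exact h1 x'
    · exact fun h => h1 x h.symm
    · exact absurd rfl hij
    · exact h2
    · exact fun h => h1 x' h.symm
    · exact fun h => h2 h.symm
    · exact absurd rfl hij
  · intro i
    fin_cases i
    · refine ⟨b u, b u', ?_, ?_, b.not_modTwoEq_one u, b.not_modTwoEq_one u', b.not_modTwoEq hu⟩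
      · simp [hθu]
      · simp [hθu']
    · refine ⟨b y, b y', ?_, ?_, b.not_modTwoEq_one y, b.not_modTwoEq_one y', b.not_modTwoEq hy⟩
      · simp [hθy, mul_assoc]
      · simp [hθy', mul_assoc]
    · refine ⟨b z, b z', ?_, ?_, b.not_modTwoEq_one z, b.not_modTwoEq_one z', b.not_modTwoEq hz⟩
      · simp [hθz, mul_assoc]
      · simp [hθz', mul_assoc]

lemma exists_product_hasThreeFixedParts {U Y : Type*}
    (b : FreeGroupBasis (Option Y ⊕ U) F) {φ : MulAut F}
    (htop : φ (b (Sum.inl none)) = (b (Sum.inl none))⁻¹)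
    (hblock : ∀ y, φ (b (Sum.inl (some y))) =
      b (Sum.inl none) * b (Sum.inl (some y)) * (b (Sum.inl none))⁻¹)
    (hfix : ∀ u, φ (b (Sum.inr u)) = b (Sum.inr u))
    [Infinite Y] (hle : Nonempty (Y ↪ U)) :
    ∃ α θ : MulAut F, θ = φ * (α * φ * α⁻¹) ∧ IsInvolution (toOut θ) ∧
      HasThreeFixedParts θ := by
  obtain ⟨ε⟩ := nonempty_option_equiv Y
  obtain ⟨δ⟩ := hle
  let e : Option (Option (Option Y)) ↪ U :=
    ((ε.optionCongr.optionCongr.trans ε.optionCongr).trans ε).toEmbedding.trans δ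
  have hφ : ∀ i, φ (φ (b i)) = b i := by
    rintro ((_ | y) | u)
    · rw [htop, map_inv, htop, inv_inv]
    · rw [hblock, map_mul, map_mul, map_inv, htop, hblock]
      group
    · rw [hfix, hfix]
  obtain ⟨α, θ, hθ, hθ2, h1, h2, -, h4, h5⟩ :=
    exists_product_of_block_copies (T := Unit) (Z := fun _ => Y) b hφ
    (fun p => Sum.inl p.2) (fun p => Sum.inr (e (some (some p.2))))
    (by
      rintro (⟨⟨⟩, z⟩ | ⟨⟨⟩, z⟩) (⟨⟨⟩, z'⟩ | ⟨⟨⟩, z'⟩) h <;>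
      simp_all)
    (fun _ => 1) (fun _ => by simp) (fun _ => Or.inl rfl) (fun p => by simp [hfix])
    (fun _ => by simp [htop]) (fun _ y => by simp [hblock])
    (by
      rintro (o | u) hi hi' α hα
      · exact absurd rfl (hi ⟨(), o⟩)
      · rw [hfix, hα _ hi hi'])
  obtain ⟨y, y', hy⟩ := exists_pair_ne Y
  refine ⟨α, θ, hθ, ⟨toOut_ne_one_of_inverts b (Sum.inl none) ⟨1, by simpa using h1 ()⟩,
    by rw [← map_pow, hθ2, map_one]⟩, ?_⟩
  refine hasThreeFixedParts_of_basis b (x := Sum.inl none) (x' := Sum.inr (e (some (some none))))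
    (u := Sum.inr (e none)) (u' := Sum.inr (e (some none))) (y := Sum.inl (some y))
    (y' := Sum.inl (some y')) (z := Sum.inr (e (some (some (some y)))))
    (z' := Sum.inr (e (some (some (some y'))))) (by simp) (by simp) (by simpa using hy)
    (by simpa using hy) (h5 _ (by simp) (by simp)) (h5 _ (by simp) (by simp)) (h2 () y) (h2 () y')
    (h4 () y) (h4 () y')

lemma exists_product_not_hasThreeFixedParts {U Y : Type*}
    (b : FreeGroupBasis (Option Y ⊕ U) F) {φ : MulAut F}
    (htop : φ (b (Sum.inl none)) = (b (Sum.inl none))⁻¹)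
    (hblock : ∀ y, φ (b (Sum.inl (some y))) =
      b (Sum.inl none) * b (Sum.inl (some y)) * (b (Sum.inl none))⁻¹)
    (hfix : ∀ u, φ (b (Sum.inr u)) = b (Sum.inr u))
    [Infinite Y] [Infinite U] :
    ∃ α θ : MulAut F, toOut θ = toOut (φ * (α * φ * α⁻¹)) ∧ IsInvolution (toOut θ) ∧
      ¬ HasThreeFixedParts θ := by
  obtain ⟨h⟩ := nonempty_option_equiv Y
  obtain ⟨f⟩ := nonempty_option_equiv U
  let s : Option Y ⊕ U ≃ Y ⊕ Option U :=
    { toFun := Sum.elim (fun o => o.elim (Sum.inr none) Sum.inl) fun u => Sum.inr (some u)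
      invFun := Sum.elim (fun y => Sum.inl (some y)) fun o => o.elim (Sum.inl none) Sum.inr
      left_inv := by rintro ((_ | _) | _) <;> rfl
      right_inv := by rintro (_ | (_ | _)) <;> rfl }
  let ρ : Equiv.Perm (Option Y ⊕ U) := s.trans (Equiv.sumCongr h.symm f)
  set α := b.permAut ρ with hα
  have α1 : α (b (Sum.inl none)) = b (Sum.inr (f none)) := b.permAut_apply ρ _
  have α2 : ∀ y, α (b (Sum.inl (some y))) = b (Sum.inl (h.symm y)) :=
    fun y => b.permAut_apply ρ _
  have α3 : ∀ u, α (b (Sum.inr u)) = b (Sum.inr (f (some u))) := fun u => b.permAut_apply ρ _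
  have hinv : ∀ {a a'}, α a = a' → α⁻¹ a' = a := by
    rintro a _ rfl
    simp
  set v := b (Sum.inr (f none)) with hv
  set ψ := MulAut.conj v⁻¹ * (α * φ * α⁻¹) with hψ
  have ψ1 : ψ v = v⁻¹ := by
    rw [hψ, MulAut.mul_apply, MulAut.conj_apply, MulAut.mul_apply, MulAut.mul_apply, hinv α1, htop,
      map_inv, α1]
    group
  have ψ2 : ∀ o, ψ (b (Sum.inl o)) = b (Sum.inl o) := by
    intro o
    obtain ⟨y, rfl⟩ := h.symm.surjective o
    rw [hψ, MulAut.mul_apply, MulAut.conj_apply, MulAut.mul_apply, MulAut.mul_apply, hinv (α2 y),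
      hblock, map_mul, map_mul, map_inv, α1, α2]
    group
  have ψ3 : ∀ u, ψ (b (Sum.inr (f (some u)))) = v⁻¹ * b (Sum.inr (f (some u))) * v := by
    intro u
    simp only [hψ, MulAut.mul_apply, hinv (α3 u), hfix, α3, MulAut.conj_apply, inv_inv]
  obtain ⟨θ, hθ⟩ : ∃ θ, θ = φ * ψ := ⟨_, rfl⟩
  have θ1 : θ v = v⁻¹ := by rw [hθ, MulAut.mul_apply, ψ1, map_inv, hfix]
  have θ2 : ∀ o, θ (b (Sum.inl o)) = φ (b (Sum.inl o)) := fun o => by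
    rw [hθ, MulAut.mul_apply, ψ2]
  have θ3 : ∀ u, θ (b (Sum.inr (f (some u)))) = v⁻¹ * b (Sum.inr (f (some u))) * v := fun u => by
    rw [hθ, MulAut.mul_apply, ψ3, map_mul, map_mul, map_inv, hfix, hfix]
  have hr : ∀ {P : Option Y ⊕ U → Prop}, P (Sum.inl none) → (∀ y, P (Sum.inl (some y))) →
      P (Sum.inr (f none)) → (∀ u, P (Sum.inr (f (some u)))) → ∀ i, P i := by
    rintro P h1 h2 h3 h4 ((_ | y) | u)
    · exact h1
    · exact h2 y
    · obtain ⟨_ | u, rfl⟩ := f.surjective u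
      · exact h3
      · exact h4 u
  have hsq : θ ^ 2 = 1 := by
    refine b.mulAut_ext (hr ?_ (fun y => ?_) ?_ fun u => ?_) <;>
      rw [pow_two, MulAut.mul_apply, MulAut.one_apply]
    · rw [θ2, htop, map_inv, θ2, htop, inv_inv]
    · rw [θ2, hblock, map_mul, map_mul, map_inv, θ2, θ2, htop, hblock]
      group
    · rw [← hv, θ1, map_inv, θ1, inv_inv]
    · rw [θ3, map_mul, map_mul, map_inv, θ1, θ3]
      group
  refine ⟨α, θ, ?_, ⟨toOut_ne_one_of_inverts b (Sum.inl none) ⟨1, by simp [θ2, htop]⟩,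
    by rw [← map_pow, hsq, map_one]⟩, ?_⟩
  · rw [hθ, hψ, map_mul, toOut_conj_mul]
    exact (map_mul _ _ _).symm
  · refine not_hasThreeFixedParts b
      (fun k => bif k then Sum.inl none else Sum.inr (f none)) Sum.isLeft ?_ ?_ ?_
    · rintro (_ | _) <;> rfl
    · rintro (_ | _)
      · exact θ1
      · exact (θ2 none).trans htop
    · refine hr (fun h => absurd rfl (h true)) (fun y _ => ?_) (fun h => absurd rfl (h false))
        fun u _ => ?_
      · exact ⟨_, Or.inl rfl, (θ2 _).trans (hblock y)⟩
      · exact ⟨_, Or.inr rfl, by simpa using θ3 u⟩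

lemma not_starCondition_of_infinite_of_embedding {U Y : Type*}
    (b : FreeGroupBasis (Option Y ⊕ U) F) {φ : MulAut F}
    (htop : φ (b (Sum.inl none)) = (b (Sum.inl none))⁻¹)
    (hblock : ∀ y, φ (b (Sum.inl (some y))) =
      b (Sum.inl none) * b (Sum.inl (some y)) * (b (Sum.inl none))⁻¹)
    (hfix : ∀ u, φ (b (Sum.inr u)) = b (Sum.inr u))
    [Infinite Y] (hle : Nonempty (Y ↪ U)) :
    ¬ StarCondition {g | IsConj (toOut φ) g} := by
  intro hstar
  have : Infinite U := Infinite.of_injective hle.some hle.some.injective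
  obtain ⟨α, θ, h1, h2, h3⟩ := exists_product_hasThreeFixedParts b htop hblock hfix hle
  obtain ⟨α', θ', h1', h2', h3'⟩ := exists_product_not_hasThreeFixedParts b htop hblock hfix
  refine h3' (h3.of_isConj (hstar.isConj (toOut_mul_conj_mem h1) ?_ h2 h2'))
  rw [h1']
  exact toOut_mul_conj_mem rfl

end OneBlock

section Conversion

lemma SoftModel.exists_basis_of_two {F : Type*} [Group F] {φ : MulAut F} {I : Type*}
    {N : I → Type*} {i₀ i₁ : I} (M : SoftModel φ N i₀) (hi : i₁ ≠ i₀)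
    (hI : ∀ i, i = i₀ ∨ i = i₁) :
    ∃ b : FreeGroupBasis (Option (N i₁) ⊕ N i₀) F,
      φ (b (Sum.inl none)) = (b (Sum.inl none))⁻¹ ∧
      (∀ y, φ (b (Sum.inl (some y))) =
        b (Sum.inl none) * b (Sum.inl (some y)) * (b (Sum.inl none))⁻¹) ∧
      ∀ u, φ (b (Sum.inr u)) = b (Sum.inr u) := by
  let v : Option (N i₁) ⊕ N i₀ → {i // i ≠ i₀} ⊕ Σ i, N i :=
    Sum.elim (fun o => o.elim (Sum.inl ⟨i₁, hi⟩) fun y => Sum.inr ⟨i₁, y⟩)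
      fun u => Sum.inr ⟨i₀, u⟩
  have hv : Function.Bijective v := by
    constructor
    · rintro ((_ | y) | u) ((_ | y') | u') h <;> simp [v, hi, hi.symm] at h ⊢
      · exact h
      · exact h
    · rintro (⟨i, h⟩ | ⟨i, y⟩)
      · obtain rfl := (hI i).resolve_left h
        exact ⟨Sum.inl none, rfl⟩
      · rcases hI i with rfl | rfl
        · exact ⟨Sum.inr y, rfl⟩
        · exact ⟨Sum.inl (some y), rfl⟩
  have hb : ∀ i, (M.basis.reindex (Equiv.ofBijective v hv).symm) i = M.basis (v i) := fun i => by
    simp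
  refine ⟨M.basis.reindex (Equiv.ofBijective v hv).symm, ?_, fun y => ?_, fun u => ?_⟩
  · rw [hb, show v (Sum.inl none) = Sum.inl ⟨i₁, hi⟩ from rfl, M.basis_inl, M.map_x]
  · rw [hb, hb, show v (Sum.inl none) = Sum.inl ⟨i₁, hi⟩ from rfl,
      show v (Sum.inl (some y)) = Sum.inr ⟨i₁, y⟩ from rfl, M.basis_inl, M.map_y]
  · rw [hb, show v (Sum.inr u) = Sum.inr ⟨i₀, u⟩ from rfl, M.map_y, M.x_base]
    group

variable {X : Type*} {φ : MulAut (FreeGroup X)}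

lemma isCanonicalBasis_of_basis {U Y : Type*} (b : FreeGroupBasis (Option Y ⊕ U) (FreeGroup X))
    (htop : φ (b (Sum.inl none)) = (b (Sum.inl none))⁻¹)
    (hblock : ∀ y, φ (b (Sum.inl (some y))) =
      b (Sum.inl none) * b (Sum.inl (some y)) * (b (Sum.inl none))⁻¹)
    (hfix : ∀ u, φ (b (Sum.inr u)) = b (Sum.inr u)) :
    IsCanonicalBasis φ (Set.range fun u => b (Sum.inr u)) {b (Sum.inl none)}
      fun _ => Set.range fun y => b (Sum.inl (some y)) := by
  refine ⟨⟨?_, ?_, ?_, ?_, ?_⟩, ?_, ?_, ?_⟩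
  · convert b.isBasis_range using 1
    ext a
    simp only [Set.mem_union, Set.mem_range, Set.mem_singleton_iff, Set.iUnion_iUnion_eq_left,
      Sum.exists, Option.exists]
    tauto
  · rw [Set.disjoint_singleton_right]
    rintro ⟨u, hu⟩
    simpa using b.injective hu
  · rintro x -
    rw [Set.disjoint_left]
    rintro _ ⟨u, rfl⟩ ⟨y, hy⟩
    simpa using b.injective hy
  · rintro x -
    rw [Set.disjoint_singleton_left]
    rintro ⟨y, hy⟩
    simpa using b.injective hy
  · rintro x rfl x' rfl h
    exact absurd rfl h
  · rintro _ ⟨u, rfl⟩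
    exact hfix u
  · rintro _ rfl
    exact htop
  · rintro _ rfl _ ⟨y, rfl⟩
    exact hblock y

lemma IsCanonicalBasis.exists_softModel {U S : Set (FreeGroup X)}
    {Y : FreeGroup X → Set (FreeGroup X)} (h : IsCanonicalBasis φ U S Y) :
    Nonempty (SoftModel φ (fun i : Option S => ↥(i.elim U fun s => Y s)) none) := by
  obtain ⟨⟨hB, hUS, hUY, hSY, hYY⟩, hU, hS, hY⟩ := h
  let x : Option S → FreeGroup X := fun i => i.elim 1 fun s => s
  let v : ({i : Option S // i ≠ none} ⊕ Σ i : Option S, ↥(i.elim U fun s => Y s)) →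
      FreeGroup X := Sum.elim (fun i => x i) fun p => (p.2 : FreeGroup X)
  have hv : Function.Injective v := by
    rintro (⟨_ | s, hi⟩ | ⟨_ | s, y, hy⟩) (⟨_ | s', hi'⟩ | ⟨_ | s', y', hy'⟩) h
    · rfl
    · exact absurd rfl hi
    · exact absurd rfl hi
    · exact absurd rfl hi
    · exact absurd rfl hi'
    · obtain rfl : s = s' := Subtype.ext h
      rfl
    · obtain rfl : (s : FreeGroup X) = y' := h
      exact absurd s.2 (Set.disjoint_left.1 hUS hy')
    · obtain rfl : (s : FreeGroup X) = y' := h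
      exact absurd hy' (Set.disjoint_left.1 (hSY s' s'.2) s.2)
    · exact absurd rfl hi'
    · obtain rfl : y = (s' : FreeGroup X) := h
      exact absurd s'.2 (Set.disjoint_left.1 hUS hy)
    · obtain rfl : y = y' := h
      rfl
    · obtain rfl : y = y' := h
      exact absurd hy' (Set.disjoint_left.1 (hUY s' s'.2) hy)
    · exact absurd rfl hi'
    · obtain rfl : y = (s' : FreeGroup X) := h
      exact absurd hy (Set.disjoint_left.1 (hSY s s.2) s'.2)
    · obtain rfl : y = y' := h
      exact absurd hy (Set.disjoint_left.1 (hUY s s.2) hy')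
    · obtain rfl : y = y' := h
      by_cases hs : s = s'
      · subst hs
        rfl
      · exact absurd hy' (Set.disjoint_left.1
          (hYY s s.2 s' s'.2 fun h => hs (Subtype.ext h)) hy)
  have hrange : Set.range v = U ∪ S ∪ ⋃ x ∈ S, Y x := by
    ext a
    simp only [Set.mem_range, Set.mem_union, Set.mem_iUnion]
    constructor
    · rintro ⟨⟨_ | s, hi⟩ | ⟨_ | s, y, hy⟩, rfl⟩
      · exact absurd rfl hi
      · exact Or.inl (Or.inr s.2)
      · exact Or.inl (Or.inl hy)
      · exact Or.inr ⟨s, s.2, hy⟩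
    · rintro ((ha | ha) | ⟨s, hs, ha⟩)
      · exact ⟨Sum.inr ⟨none, a, ha⟩, rfl⟩
      · exact ⟨Sum.inl ⟨some ⟨a, ha⟩, by simp⟩, rfl⟩
      · exact ⟨Sum.inr ⟨some ⟨s, hs⟩, a, ha⟩, rfl⟩
  rw [← hrange] at hB
  have hb : ∀ i, (hB.basis.reindex (Equiv.ofInjective v hv).symm) i = v i := fun i => by simp
  refine ⟨⟨hB.basis.reindex (Equiv.ofInjective v hv).symm, x, rfl, fun i => hb _, ?_, ?_⟩⟩
  · rintro (_ | s)
    · change φ 1 = 1⁻¹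
      simp
    · exact hS s s.2
  · intro i y
    rw [hb]
    rcases i with _ | s
    · change φ (y : FreeGroup X) = 1 * y * 1⁻¹
      rw [hU _ y.2]
      group
    · exact hY s s.2 y y.2

end Conversion

/-- If a conjugacy class `K ⊆ Out F` of soft involutions satisfies condition (★), then `K`
is the conjugacy class of an involution `ψ̂` where `ψ ∈ Aut F` is a `1`-involution with a
canonical basis `U ⊔ {x} ⊔ Y` whose block part `Y` is finite. -/
theorem star_condition_class_is_finite_block (X : Type*) [Infinite X]
    (K : Set (OutAut (FreeGroup X)))
    (hK : ∃ f : OutAut (FreeGroup X), IsSoftOutInvolution f ∧ K = {g | IsConj f g})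
    (hstar : StarCondition K) :
    ∃ (ψ : MulAut (FreeGroup X)) (U Y : Set (FreeGroup X)) (x : FreeGroup X),
      IsInvolution ψ ∧ Y.Finite ∧ IsCanonicalBasis ψ U {x} (fun _ => Y) ∧
      K = {g | IsConj (toOut ψ) g} := by
  obtain ⟨f, ⟨⟨hf, -⟩, φ, ⟨-, U, S, Y, hcan⟩, rfl⟩, rfl⟩ := hK
  obtain ⟨M⟩ := hcan.exists_softModel
  have hinf : Infinite (Option S) ∨ ∃ i : Option S, Infinite ↥(i.elim U fun s => Y s) := by
    by_contra! hfin
    obtain ⟨h1, h2⟩ := hfin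
    have := M.basis.infinite_index
    exact not_finite ({i : Option S // i ≠ none} ⊕ Σ i : Option S, ↥(i.elim U fun s => Y s))
  obtain ⟨s⟩ : Nonempty S := by
    by_contra hS
    refine hf ?_
    rw [← map_one toOut]
    congr 1
    refine M.basis.mulAut_ext ?_
    rintro (⟨_ | s, hi⟩ | ⟨_ | s, y⟩)
    · exact absurd rfl hi
    · exact absurd ⟨s⟩ hS
    · rw [M.map_y, M.x_base]
      simp
    · exact absurd ⟨s⟩ hS
  have hI : ∀ i : Option S, i = none ∨ i = some s := by
    rintro (_ | s')
    · exact Or.inl rfl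
    · refine Or.inr (by_contra fun hne => ?_)
      exact M.not_starCondition_of_three (Option.some_ne_none s').symm (Option.some_ne_none s).symm
        hne hinf hstar
  have hinv : ∀ {ψ : MulAut (FreeGroup X)}, toOut ψ = toOut φ → ψ ^ 2 = 1 → IsInvolution ψ :=
    fun h h' => ⟨fun h1 => hf (by rw [← h, h1, map_one]), h'⟩
  obtain ⟨b, h1, h2, h3⟩ := M.exists_basis_of_two (Option.some_ne_none s) hI
  obtain ⟨M'⟩ := M.baseChange (some s)
  have hψ : toOut (MulAut.conj (M.x (some s))⁻¹ * φ) = toOut φ := toOut_conj_mul _ _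
  obtain ⟨b', h1', h2', h3'⟩ := M'.exists_basis_of_two (Option.some_ne_none s).symm
    fun i => (hI i).symm
  rcases finite_or_infinite (Y s) with hY | hY
  · exact ⟨φ, _, _, _, hinv rfl M.sq_eq_one,
      Set.finite_range (ι := Y s) _, isCanonicalBasis_of_basis b h1 h2 h3, rfl⟩
  rcases finite_or_infinite U with hU | hU
  · exact ⟨_, _, _, _, hinv hψ M'.sq_eq_one,
      Set.finite_range (ι := U) _, isCanonicalBasis_of_basis b' h1' h2' h3', by rw [hψ]⟩
  exfalso
  rcases Function.Embedding.total (Y s) U with h | h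
  · exact not_starCondition_of_infinite_of_embedding (Y := Y s) (U := U) b h1 h2 h3 h hstar
  · rw [← hψ] at hstar
    exact not_starCondition_of_infinite_of_embedding (Y := U) (U := Y s) b' h1' h2' h3' h hstar
end

section
/- Let φ ∈ Aut(F) be a 1-involution with a canonical basis {x} ⊔ Y ⊔ U such that φx = x⁻¹, φy = x y x⁻¹ for all y ∈ Y, and φu = u for all u ∈ U, where |Y| < |U| = κ. Then an element s ∈ Out(F) commutes with φ̂ if and only if there is σ ∈ Aut(F) in the preimage of s which commutes with φ. -/
open Pointwise

namespace Monoid.CoprodI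

variable {ι : Type*} {G : ι → Type*} [∀ i, Group (G i)]

/-- The formal inverse of a list of letters of a free product of groups. -/
def invList (l : List (Σ i, G i)) : List (Σ i, G i) :=
  (l.map fun a => (⟨a.1, a.2⁻¹⟩ : Σ i, G i)).reverse

theorem prod_invList (l : List (Σ i, G i)) :
    ((invList l).map fun a => (of a.2 : CoprodI G)).prod =
      (l.map fun a => (of a.2 : CoprodI G)).prod⁻¹ := by
  induction l with
  | nil => simp [invList]
  | cons a l ih =>
    simp only [invList, List.map_cons, List.reverse_cons, List.map_append, List.prod_append,
      List.prod_cons, mul_inv_rev, List.map_nil, List.prod_nil, mul_one, map_inv] at ih ⊢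
    rw [ih]

theorem isChain_invList {l : List (Σ i, G i)} (h : l.IsChain fun a b => a.1 ≠ b.1) :
    (invList l).IsChain fun a b => a.1 ≠ b.1 := by
  rw [invList, List.isChain_reverse, List.isChain_map]
  exact h.imp fun _ _ hab => hab.symm

theorem invList_ne_one {l : List (Σ i, G i)} (h : ∀ a ∈ l, a.2 ≠ 1) :
    ∀ a ∈ invList l, a.2 ≠ 1 := by
  intro a ha
  simp only [invList, List.mem_reverse, List.mem_map] at ha
  obtain ⟨b, hb, rfl⟩ := ha
  simpa using h b hb

theorem Word.prod_injective : Function.Injective (Word.prod : Word G → CoprodI G) := by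
  classical
  exact Word.equiv.symm.injective

theorem exists_word_prod_eq (c : CoprodI G) : ∃ w : Word G, w.prod = c := by
  classical
  exact Word.equiv.symm.surjective c

theorem prod_eq_conj_of_eq_invList (l : List (Σ i, G i)) (hchain : l.IsChain fun a b => a.1 ≠ b.1)
    (hl : l = invList l) :
    l = [] ∨ ∃ (v : CoprodI G) (i : ι) (m : G i), m * m = 1 ∧
      (l.map fun a => (of a.2 : CoprodI G)).prod = v * of m * v⁻¹ := by
  induction l using List.bidirectionalRec with
  | nil => exact Or.inl rfl
  | singleton a =>
    obtain ⟨i, m⟩ := a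
    refine Or.inr ⟨1, i, m, ?_, by simp⟩
    simp only [invList, List.map_cons, List.map_nil, List.reverse_cons, List.reverse_nil,
      List.nil_append, List.cons.injEq, Sigma.mk.injEq, heq_eq_eq, true_and, and_true] at hl
    exact mul_eq_one_iff_eq_inv.2 hl
  | cons_append a l b ih =>
    have hsplit : a = ⟨b.1, b.2⁻¹⟩ ∧ l = invList l := by
      simp only [invList, List.map_cons, List.map_append, List.map_nil, List.reverse_cons,
        List.reverse_append, List.reverse_nil, List.nil_append, List.cons_append,
        List.cons.injEq] at hl
      exact ⟨hl.1, (List.append_inj' hl.2 rfl).1⟩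
    obtain ⟨rfl, hl'⟩ := hsplit
    rw [List.isChain_cons] at hchain
    rcases ih (List.isChain_append.1 hchain.2).1 hl' with rfl | ⟨v, i, m, hm, hv⟩
    · simp at hchain
    · refine Or.inr ⟨(of b.2)⁻¹ * v, i, m, hm, ?_⟩
      simp [hv, mul_assoc]

/-- An element of order at most two of a free product is conjugate into a factor. -/
theorem eq_one_or_exists_conj_of_mul_self_eq_one {c : CoprodI G} (hc : c * c = 1) :
    c = 1 ∨ ∃ (v : CoprodI G) (i : ι) (m : G i), m * m = 1 ∧ c = v * of m * v⁻¹ := by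
  obtain ⟨w, rfl⟩ := exists_word_prod_eq c
  let w' : Word G := ⟨invList w.toList, invList_ne_one w.ne_one, isChain_invList w.chain_ne⟩
  have hw : w = w' := Word.prod_injective
    ((mul_eq_one_iff_eq_inv.1 hc).trans (prod_invList w.toList).symm)
  rcases prod_eq_conj_of_eq_invList w.toList w.chain_ne (congrArg Word.toList hw) with h | h
  · left
    simp [Word.prod, h]
  · exact Or.inr h

/-- A reduced word whose last letter does not lie in the factor `i` and which conjugates a
nontrivial element of that factor into the factor is empty. -/
theorem eq_nil_of_conj_of_eq_of {i : ι} {l : List (Σ i, G i)} (hne : ∀ a ∈ l, a.2 ≠ 1)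
    (hchain : l.IsChain fun a b => a.1 ≠ b.1) (hlast : ∀ a ∈ l.getLast?, a.1 ≠ i)
    {m n : G i} (hm : m ≠ 1)
    (h : (l.map fun a => (of a.2 : CoprodI G)).prod * of m *
      ((l.map fun a => (of a.2 : CoprodI G)).prod)⁻¹ = of n) : l = [] := by
  have hn : n ≠ 1 := by
    rintro rfl
    rw [map_one, conj_eq_one_iff] at h
    exact hm (of_injective i (h.trans (map_one _).symm))
  have hhead : ∀ a ∈ (invList l).head?, i ≠ a.1 := by
    intro a ha
    simp only [invList, List.head?_reverse, List.getLast?_map, Option.mem_def,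
      Option.map_eq_some_iff] at ha
    obtain ⟨b, hb, rfl⟩ := ha
    exact (hlast b hb).symm
  let w₁ : Word G := ⟨l ++ ⟨i, m⟩ :: invList l, by
      intro a ha
      simp only [List.mem_append, List.mem_cons] at ha
      rcases ha with ha | rfl | ha
      · exact hne a ha
      · exact hm
      · exact invList_ne_one hne a ha, by
      refine List.isChain_append.2 ⟨hchain, List.isChain_cons.2 ⟨hhead, isChain_invList hchain⟩, ?_⟩
      simpa using hlast⟩
  let w₂ : Word G := ⟨[⟨i, n⟩], by simpa using hn, by simp⟩
  have hw : w₁ = w₂ := Word.prod_injective <| by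
    simp only [Word.prod, w₁, w₂, List.map_append, List.map_cons, List.prod_append,
      List.prod_cons, prod_invList, ← mul_assoc, h, List.map_nil, List.prod_nil, mul_one]
  have hlen := congrArg (fun w : Word G => w.toList.length) hw
  simp only [w₁, w₂, List.length_append, List.length_cons, List.length_nil] at hlen
  exact List.length_eq_zero_iff.1 (by omega)

/-- The centralizer of a nontrivial element of a factor is contained in that factor. -/
theorem mem_range_of_of_commute {i : ι} {m : G i} (hm : m ≠ 1) {c : CoprodI G}
    (hc : Commute c (of m)) : c ∈ (of : G i →* CoprodI G).range := by
  obtain ⟨⟨l, hne, hchain⟩, rfl⟩ := exists_word_prod_eq c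
  simp only [Word.prod] at hc ⊢
  have hconj := mul_inv_eq_iff_eq_mul.2 hc.eq
  by_cases hlast : ∀ a ∈ l.getLast?, a.1 ≠ i
  · rw [eq_nil_of_conj_of_eq_of hne hchain hlast hm hconj]
    exact ⟨1, by simp⟩
  · push Not at hlast
    obtain ⟨⟨_, k⟩, ha, rfl⟩ := hlast
    obtain ⟨l, rfl⟩ := List.getLast?_eq_some_iff.1 ha
    have hl : l = [] := by
      refine eq_nil_of_conj_of_eq_of (m := k * m * k⁻¹) (n := m)
        (fun a ha => hne a (by simp [ha])) (List.isChain_append.1 hchain).1 ?_ ?_ ?_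
      · intro a ha
        exact (List.isChain_append.1 hchain).2.2 a ha ⟨_, k⟩ (by simp)
      · simpa using hm
      · simpa [mul_assoc] using hconj
    subst hl
    exact ⟨k, by simp⟩

/-- Distinct factors intersect trivially. -/
theorem of_eq_of_imp_eq_one {i j : ι} (hij : i ≠ j) {m : G i} {n : G j}
    (h : (of m : CoprodI G) = of n) : m = 1 := by
  classical
  have := congrArg (lift (Pi.mulSingle i (MonoidHom.id (G i)))) h
  simpa [lift_of, Pi.mulSingle_eq_of_ne hij.symm] using this

end Monoid.CoprodI

namespace FreeGroup.IsBasis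

variable {X : Type*} {S : Set (FreeGroup X)} {H : Type*} [Group H]

/-- The isomorphism onto a free group given by one of its bases. -/
noncomputable def equiv (hS : IsBasis S) : FreeGroup S ≃* FreeGroup X :=
  MulEquiv.ofBijective _ hS

theorem equiv_of (hS : IsBasis S) (s : S) : hS.equiv (FreeGroup.of s) = s :=
  FreeGroup.lift_apply_of

theorem equiv_symm_apply (hS : IsBasis S) (s : S) : hS.equiv.symm s = FreeGroup.of s := by
  rw [MulEquiv.symm_apply_eq, equiv_of]

theorem exists_hom (hS : IsBasis S) (f : S → H) :
    ∃ Φ : FreeGroup X →* H, ∀ s : S, Φ s = f s :=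
  ⟨(FreeGroup.lift f).comp hS.equiv.symm.toMonoidHom, fun s => by
    simp [equiv_symm_apply]⟩

theorem hom_ext (hS : IsBasis S) {f g : FreeGroup X →* H} (h : ∀ s ∈ S, f s = g s) : f = g := by
  have hcomp : f.comp hS.equiv.toMonoidHom = g.comp hS.equiv.toMonoidHom := by
    ext s
    simpa [equiv_of] using h s s.2
  ext1 a
  simpa using DFunLike.congr_fun hcomp (hS.equiv.symm (FreeGroup.of a))

/-- Only the identity commutes with two distinct elements of a basis. -/
theorem eq_one_of_commute (hS : IsBasis S) {a b k : FreeGroup X} (ha : a ∈ S) (hb : b ∈ S)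
    (hab : a ≠ b) (hka : Commute k a) (hkb : Commute k b) : k = 1 := by
  let Ψ := hS.equiv.symm.trans (freeGroupEquivCoprodI (ι := S))
  have hΨ (s : S) : Ψ s = Monoid.CoprodI.of (i := s) (FreeGroup.of ()) := by
    simp [Ψ, equiv_symm_apply, freeGroupEquivCoprodI]
  have hne : (FreeGroup.of () : FreeGroup Unit) ≠ 1 := FreeGroup.of_ne_one ()
  have hmem (s : S) (hks : Commute k s) :
      Ψ k ∈ (Monoid.CoprodI.of (M := fun _ : S => FreeGroup Unit) (i := s)).range := by
    refine Monoid.CoprodI.mem_range_of_of_commute (G := fun _ : S => FreeGroup Unit) hne ?_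
    rw [← hΨ s]
    exact hks.map Ψ
  obtain ⟨m, hm⟩ := hmem ⟨a, ha⟩ hka
  obtain ⟨n, hn⟩ := hmem ⟨b, hb⟩ hkb
  have hm1 : m = 1 := Monoid.CoprodI.of_eq_of_imp_eq_one
    (fun h => hab (congrArg Subtype.val h)) (hm.trans hn.symm)
  rw [hm1, _root_.map_one] at hm
  exact (map_eq_one_iff Ψ Ψ.injective).1 hm.symm

/-- An automorphism cannot move a part `U` of a basis into a subgroup generated by fewer than `|U|`
elements. -/
theorem mk_le_of_forall_mem_closure (hS : IsBasis S) {U Y : Set (FreeGroup X)} (hU : U ⊆ S)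
    (σ : MulAut (FreeGroup X)) (h : ∀ u ∈ U, σ u ∈ Subgroup.closure Y) :
    Cardinal.mk U ≤ Cardinal.mk Y := by
  classical
  obtain ⟨d, hd⟩ := hS.exists_hom (H := Multiplicative (U →₀ ℚ)) fun s =>
    if hs : (s : FreeGroup X) ∈ U then .ofAdd (Finsupp.single ⟨s, hs⟩ 1) else 1
  let f : FreeGroup X → (U →₀ ℚ) := fun g => (d (σ⁻¹ g)).toAdd
  have hspan (g : FreeGroup X) (hg : g ∈ Subgroup.closure Y) :
      f g ∈ Submodule.span ℚ (Set.image f Y) := by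
    induction hg using Subgroup.closure_induction with
    | mem y hy => exact Submodule.subset_span ⟨y, hy, rfl⟩
    | one => simp [f]
    | mul a b _ _ iha ihb => simpa [f] using add_mem iha ihb
    | inv a _ iha => simpa [f] using iha
  have htop : Submodule.span ℚ (Set.image f Y) = ⊤ := by
    rw [eq_top_iff, ← (Finsupp.basisSingleOne (R := ℚ) (ι := U)).span_eq, Submodule.span_le]
    rintro _ ⟨u, rfl⟩
    have := hspan _ (h u u.2)
    simpa [f, hd ⟨u, hU u.2⟩] using this
  have hrank := rank_span_le (R := ℚ) (Set.image f Y)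
  rw [htop, rank_top, rank_finsupp_self, Cardinal.lift_uzero] at hrank
  exact hrank.trans Cardinal.mk_image_le

end FreeGroup.IsBasis

section Factor

variable {F : Type*} [Group F]

/-- The group of automorphisms generated by `τ` and the conjugations by the elements of `S`. -/
def factor (τ : MulAut F) (S : Set F) : Subgroup (MulAut F) :=
  Subgroup.closure (insert τ (Set.image MulAut.conj S))

theorem self_mem_factor (τ : MulAut F) (S : Set F) : τ ∈ factor τ S :=
  Subgroup.subset_closure (Set.mem_insert _ _)

theorem conj_mem_factor (τ : MulAut F) {S : Set F} {g : F} (hg : g ∈ S) :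
    MulAut.conj g ∈ factor τ S :=
  Subgroup.subset_closure (Set.mem_insert_of_mem _ ⟨g, hg, rfl⟩)

theorem mul_conj_eq (τ : MulAut F) (g : F) : τ * MulAut.conj g = MulAut.conj (τ g) * τ := by
  ext a
  simp

theorem exists_eq_of_mem_factor {τ : MulAut F} {S : Set F} (hτ : τ * τ = 1)
    (hS : ∀ g ∈ S, τ g = g) {α : MulAut F} (hα : α ∈ factor τ S) :
    ∃ h ∈ Subgroup.closure S, τ h = h ∧ (α = MulAut.conj h ∨ α = MulAut.conj h * τ) := by
  have hinv : τ⁻¹ = τ := inv_eq_of_mul_eq_one_left hτ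
  induction hα using Subgroup.closure_induction with
  | mem α hα =>
    rcases hα with rfl | ⟨g, hg, rfl⟩
    · exact ⟨1, one_mem _, map_one _, Or.inr (by simp)⟩
    · exact ⟨g, Subgroup.subset_closure hg, hS g hg, Or.inl rfl⟩
  | one => exact ⟨1, one_mem _, map_one _, Or.inl (by simp)⟩
  | mul α β _ _ iha ihb =>
    obtain ⟨h, hh, hτh, ha⟩ := iha
    obtain ⟨k, hk, hτk, hb⟩ := ihb
    have hcomm : τ * MulAut.conj k = MulAut.conj k * τ := by rw [mul_conj_eq, hτk]
    refine ⟨h * k, mul_mem hh hk, by rw [map_mul, hτh, hτk], ?_⟩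
    rcases ha with rfl | rfl <;> rcases hb with rfl | rfl
    · exact Or.inl (map_mul _ _ _).symm
    · exact Or.inr (by rw [map_mul, mul_assoc])
    · exact Or.inr (by rw [map_mul, mul_assoc, hcomm, mul_assoc])
    · exact Or.inl (by rw [map_mul, mul_assoc, ← mul_assoc τ, hcomm, mul_assoc, hτ, mul_one])
  | inv α _ ih =>
    obtain ⟨h, hh, hτh, ha⟩ := ih
    have hτh' : τ h⁻¹ = h⁻¹ := by rw [map_inv, hτh]
    refine ⟨h⁻¹, inv_mem hh, hτh', ?_⟩
    rcases ha with rfl | rfl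
    · exact Or.inl (map_inv _ _).symm
    · exact Or.inr (by rw [mul_inv_rev, hinv, ← map_inv, mul_conj_eq, hτh'])

open Monoid

variable {ι : Type*} {τ : ι → MulAut F} {S : ι → Set F}

/-- The canonical homomorphism from the free product of the factors to the automorphism group. -/
def factorHom (τ : ι → MulAut F) (S : ι → Set F) :
    CoprodI (fun i => factor (τ i) (S i)) →* MulAut F :=
  CoprodI.lift fun i => (factor (τ i) (S i)).subtype

/-- The generator `τ i` as an element of the free product of the factors. -/
def factorGen (τ : ι → MulAut F) (S : ι → Set F) (i : ι) :
    CoprodI (fun i => factor (τ i) (S i)) :=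
  CoprodI.of (⟨τ i, self_mem_factor _ _⟩ : factor (τ i) (S i))

theorem factorHom_factorGen (i : ι) : factorHom τ S (factorGen τ S i) = τ i := by
  simp [factorHom, factorGen]

theorem factorGen_mul_self (hτ : ∀ i, τ i * τ i = 1) (i : ι) :
    factorGen τ S i * factorGen τ S i = 1 := by
  rw [factorGen, ← map_mul, MulMemClass.mk_mul_mk]
  simp only [hτ i]
  exact map_one _

/-- Conjugation by an element of `S i` as an element of the free product of the factors. -/
def factorConj (τ : ι → MulAut F) (S : ι → Set F) (i : ι) (g : S i) :
    CoprodI (fun i => factor (τ i) (S i)) :=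
  CoprodI.of (⟨MulAut.conj (g : F), conj_mem_factor _ g.2⟩ : factor (τ i) (S i))

theorem factorHom_factorConj (i : ι) (g : S i) :
    factorHom τ S (factorConj τ S i g) = MulAut.conj (g : F) := by
  simp [factorHom, factorConj]

theorem factorGen_mul_factorConj (hS : ∀ i, ∀ g ∈ S i, τ i g = g) (i : ι) (g : S i) :
    factorGen τ S i * factorConj τ S i g = factorConj τ S i g * factorGen τ S i := by
  simp only [factorGen, factorConj, ← map_mul, MulMemClass.mk_mul_mk, mul_conj_eq, hS i g g.2]

/-- The fixed points of `τ i` lie in the subgroup generated by `S i`. -/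
theorem mem_closure_of_fixed
    (hconj : Function.Injective (MulAut.conj : F →* MulAut F)) (hτ : ∀ i, τ i * τ i = 1)
    (hS : ∀ i, ∀ g ∈ S i, τ i g = g) (Φ : F →* CoprodI fun i => factor (τ i) (S i))
    (hΦ : ∀ g, factorHom τ S (Φ g) = MulAut.conj g)
    (hΦτ : ∀ i g, Φ (τ i g) = factorGen τ S i * Φ g * (factorGen τ S i)⁻¹)
    {i : ι} (hout : τ i ∉ Inn F) {g : F} (hg : τ i g = g) :
    g ∈ Subgroup.closure (S i) := by
  have hne : (⟨τ i, self_mem_factor _ _⟩ : factor (τ i) (S i)) ≠ 1 := by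
    intro h
    have h1 : τ i = 1 := congrArg Subtype.val h
    exact hout (h1 ▸ one_mem _)
  obtain ⟨m, hm⟩ := CoprodI.mem_range_of_of_commute hne (c := Φ g)
    (mul_inv_eq_iff_eq_mul.1 (by rw [← factorGen, ← hΦτ, hg])).symm
  have hgm : (m : MulAut F) = MulAut.conj g := by
    rw [← hΦ, ← hm]
    simp [factorHom]
  obtain ⟨h, hh, -, hmh | hmh⟩ := exists_eq_of_mem_factor (hτ i) (hS i) m.2
  · rwa [hconj (hgm.symm.trans hmh)]
  · refine absurd ⟨h⁻¹ * g, ?_⟩ hout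
    rw [map_mul, ← hgm, hmh, map_inv, inv_mul_cancel_left]

/-- An involution in the coset of `τ i` modulo inner automorphisms is conjugate to some `τ j`. -/
theorem exists_conj_of_mul_self_eq_one [IsMulTorsionFree F]
    (hconj : Function.Injective (MulAut.conj : F →* MulAut F)) (hτ : ∀ i, τ i * τ i = 1)
    (hS : ∀ i, ∀ g ∈ S i, τ i g = g) (Φ : F →* CoprodI fun i => factor (τ i) (S i))
    (hΦ : ∀ g, factorHom τ S (Φ g) = MulAut.conj g)
    (hΦτ : ∀ i g, Φ (τ i g) = factorGen τ S i * Φ g * (factorGen τ S i)⁻¹)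
    {i : ι} {w : F} (hw : w * τ i w = 1)
    (hne : MulAut.conj w * τ i ≠ 1) :
    ∃ v j, MulAut.conj w * τ i = factorHom τ S v * τ j * (factorHom τ S v)⁻¹ := by
  have hc : (Φ w * factorGen τ S i) * (Φ w * factorGen τ S i) = 1 := by
    have := congrArg Φ hw
    rw [map_mul, map_one, hΦτ, inv_eq_of_mul_eq_one_left (factorGen_mul_self hτ i)] at this
    rw [← this]
    group
  have himage : factorHom τ S (Φ w * factorGen τ S i) = MulAut.conj w * τ i := by
    rw [map_mul, hΦ, factorHom_factorGen]
  rcases CoprodI.eq_one_or_exists_conj_of_mul_self_eq_one hc with h1 | ⟨v, j, m, hm, h⟩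
  · rw [h1, map_one] at himage
    exact absurd himage.symm hne
  have hm' : (m : MulAut F) * m = 1 := congrArg Subtype.val hm
  have hval : MulAut.conj w * τ i = factorHom τ S v * m * (factorHom τ S v)⁻¹ := by
    rw [← himage, h]
    simp [factorHom]
  obtain ⟨k, -, hk, hmk⟩ := exists_eq_of_mem_factor (hτ j) (hS j) m.2
  have hk1 : k = 1 := by
    have hkk : MulAut.conj (k ^ 2) = 1 := by
      rcases hmk with hmk | hmk
      · rwa [hmk, ← map_mul, ← sq] at hm'
      · rwa [hmk, mul_assoc, ← mul_assoc (τ j), mul_conj_eq, hk, mul_assoc, hτ, mul_one,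
          ← map_mul, ← sq] at hm'
    exact (pow_eq_one_iff_left two_ne_zero).1 (hconj (hkk.trans (map_one _).symm))
  rw [hk1, map_one, one_mul] at hmk
  rcases hmk with hmk | hmk
  · exact absurd (by rw [hval, hmk, mul_one, mul_inv_cancel]) hne
  · exact ⟨v, j, by rw [hval, hmk]⟩

end Factor

section OneInvolution

open Monoid

variable {X : Type*} {φ : MulAut (FreeGroup X)} {U Y : Set (FreeGroup X)} {x : FreeGroup X}

theorem IsBasisDecomposition.isBasis_singleton (hB : IsBasisDecomposition U {x} fun _ => Y) :
    FreeGroup.IsBasis (U ∪ {x} ∪ Y) := by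
  simpa using hB.isBasis

theorem IsBasisDecomposition.exists_hom {H : Type*} [Group H]
    (hB : IsBasisDecomposition U {x} fun _ => Y) (f : U → H) (a : H) (g : Y → H) :
    ∃ Φ : FreeGroup X →* H, (∀ u : U, Φ u = f u) ∧ Φ x = a ∧ ∀ y : Y, Φ y = g y := by
  classical
  have hxU : x ∉ U := Set.disjoint_singleton_right.1 hB.disjUS
  have hxY : x ∉ Y := Set.disjoint_singleton_left.1 (hB.disjSY x rfl)
  obtain ⟨Φ, hΦ⟩ := hB.isBasis_singleton.exists_hom fun s =>
    if hU : (s : FreeGroup X) ∈ U then f ⟨s, hU⟩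
    else if hY : (s : FreeGroup X) ∈ Y then g ⟨s, hY⟩ else a
  refine ⟨Φ, fun u => ?_, ?_, fun y => ?_⟩
  · simpa using hΦ ⟨u, by simp⟩
  · simpa [hxU, hxY] using hΦ ⟨x, by simp⟩
  · have hyU : (y : FreeGroup X) ∉ U := Set.disjoint_right.1 (hB.disjUY x rfl) y.2
    simpa [hyU] using hΦ ⟨y, by simp⟩

/-- The automorphisms `φ` and `g ↦ x⁻¹ * φ g * x`. -/
def blockAut (φ : MulAut (FreeGroup X)) (x : FreeGroup X) : Bool → MulAut (FreeGroup X)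
  | true => φ
  | false => MulAut.conj x⁻¹ * φ

/-- The parts of a canonical basis fixed by the two automorphisms `blockAut φ x`. -/
def blockFixed (U Y : Set (FreeGroup X)) : Bool → Set (FreeGroup X)
  | true => U
  | false => Y

theorem blockAut_mul_self (hφ : φ * φ = 1) (hx : φ x = x⁻¹) (i : Bool) :
    blockAut φ x i * blockAut φ x i = 1 := by
  cases i
  · rw [blockAut, mul_assoc, ← mul_assoc φ, mul_conj_eq, mul_assoc, hφ, mul_one, ← map_mul,
      map_inv, hx, inv_inv, inv_mul_cancel, map_one]
  · exact hφ

theorem blockAut_apply_of_mem (hB : IsCanonicalBasis φ U {x} fun _ => Y) (i : Bool) :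
    ∀ g ∈ blockFixed U Y i, blockAut φ x i g = g := by
  intro g hg
  cases i
  · simp [blockAut, hB.2.2.2 x rfl g hg, mul_assoc]
  · exact hB.2.1 g hg

theorem exists_hom_factors (hφ : φ * φ = 1) (hB : IsCanonicalBasis φ U {x} fun _ => Y) :
    ∃ Φ : FreeGroup X →* CoprodI fun i => factor (blockAut φ x i) (blockFixed U Y i),
      (∀ g, factorHom (blockAut φ x) (blockFixed U Y) (Φ g) = MulAut.conj g) ∧
      ∀ i g, Φ (blockAut φ x i g) = factorGen (blockAut φ x) (blockFixed U Y) i * Φ g *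
        (factorGen (blockAut φ x) (blockFixed U Y) i)⁻¹ := by
  have hx : φ x = x⁻¹ := hB.2.2.1 x rfl
  let t := factorGen (blockAut φ x) (blockFixed U Y)
  have ht (i : Bool) : t i * t i = 1 := factorGen_mul_self (blockAut_mul_self hφ hx) i
  have htinv (i : Bool) : (t i)⁻¹ = t i := inv_eq_of_mul_eq_one_left (ht i)
  have hfix := blockAut_apply_of_mem hB
  obtain ⟨cU, hcU, hcU'⟩ : ∃ c : U → CoprodI fun i => factor (blockAut φ x i) (blockFixed U Y i),
      (∀ u, t true * c u = c u * t true) ∧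
      ∀ u, factorHom (blockAut φ x) (blockFixed U Y) (c u) = MulAut.conj (u : FreeGroup X) :=
    ⟨factorConj (blockAut φ x) (blockFixed U Y) true, factorGen_mul_factorConj hfix true,
      factorHom_factorConj (τ := blockAut φ x) (S := blockFixed U Y) true⟩
  obtain ⟨cY, hcY, hcY'⟩ : ∃ c : Y → CoprodI fun i => factor (blockAut φ x i) (blockFixed U Y i),
      (∀ y, t false * c y = c y * t false) ∧
      ∀ y, factorHom (blockAut φ x) (blockFixed U Y) (c y) = MulAut.conj (y : FreeGroup X) :=
    ⟨factorConj (blockAut φ x) (blockFixed U Y) false, factorGen_mul_factorConj hfix false,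
      factorHom_factorConj (τ := blockAut φ x) (S := blockFixed U Y) false⟩
  obtain ⟨Φ, hΦU, hΦx, hΦY⟩ := hB.1.exists_hom cU (t true * t false) cY
  have hΦφ (g : FreeGroup X) : Φ (φ g) = t true * Φ g * (t true)⁻¹ := by
    suffices h : Φ.comp φ.toMonoidHom = (MulAut.conj (t true)).toMonoidHom.comp Φ from
      DFunLike.congr_fun h g
    refine hB.1.isBasis_singleton.hom_ext ?_
    rintro g ((hg | rfl) | hg)
    · change Φ (φ g) = t true * Φ g * (t true)⁻¹
      rw [hB.2.1 g hg, hΦU ⟨g, hg⟩, hcU, mul_inv_cancel_right]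
    · change Φ (φ g) = t true * Φ g * (t true)⁻¹
      rw [hx, map_inv, hΦx, mul_inv_rev, htinv, htinv, ← mul_assoc, ht, one_mul]
    · change Φ (φ g) = t true * Φ g * (t true)⁻¹
      rw [hB.2.2.2 x rfl g hg, map_mul, map_mul, map_inv, hΦx, hΦY ⟨g, hg⟩, mul_assoc (t true),
        hcY, mul_inv_rev, ← mul_assoc, ← mul_assoc, mul_inv_cancel_right]
  refine ⟨Φ, fun g => ?_, fun i g => ?_⟩
  · suffices h : (factorHom _ _).comp Φ = MulAut.conj from DFunLike.congr_fun h g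
    refine hB.1.isBasis_singleton.hom_ext ?_
    rintro g ((hg | rfl) | hg)
    · rw [MonoidHom.comp_apply, hΦU ⟨g, hg⟩, hcU']
    · rw [MonoidHom.comp_apply, hΦx, map_mul, factorHom_factorGen, factorHom_factorGen, blockAut,
        blockAut, ← mul_assoc, mul_conj_eq, mul_assoc, hφ, mul_one, map_inv, hx, inv_inv]
    · rw [MonoidHom.comp_apply, hΦY ⟨g, hg⟩, hcY']
  · cases i
    · change Φ (x⁻¹ * φ g * x⁻¹⁻¹) = t false * Φ g * (t false)⁻¹
      rw [map_mul, map_mul, inv_inv, map_inv, hΦφ, hΦx]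
      simp only [mul_inv_rev, mul_assoc, inv_mul_cancel_left]
      rw [htinv]
    · exact hΦφ g

theorem factorHom_mem_sup (v : CoprodI fun i => factor (blockAut φ x i) (blockFixed U Y i)) :
    factorHom (blockAut φ x) (blockFixed U Y) v ∈ Inn (FreeGroup X) ⊔ Subgroup.zpowers φ := by
  have hφmem : φ ∈ Inn (FreeGroup X) ⊔ Subgroup.zpowers φ :=
    Subgroup.mem_sup_right (Subgroup.mem_zpowers φ)
  have hinn (g : FreeGroup X) : MulAut.conj g ∈ Inn (FreeGroup X) ⊔ Subgroup.zpowers φ :=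
    Subgroup.mem_sup_left ⟨g, rfl⟩
  refine CoprodI.lift_range_le _ _ (fun i => ?_) ⟨v, rfl⟩
  rw [Subgroup.range_subtype, factor, Subgroup.closure_le]
  rintro _ (rfl | ⟨g, -, rfl⟩)
  · cases i
    · exact mul_mem (hinn _) hφmem
    · exact hφmem
  · exact hinn g

end OneInvolution

/-- Let `φ ∈ Aut F` be a `1`-involution with canonical basis `{x} ⊔ Y ⊔ U`, where
`|Y| < |U| = κ = rank F`. Then `s ∈ Out F` commutes with `φ̂` iff some preimage
`σ ∈ Aut F` of `s` commutes with `φ`. -/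
theorem commuting_with_one_involution (X : Type*) [Infinite X]
    (φ : MulAut (FreeGroup X)) (hφ : IsInvolution φ)
    (U Y : Set (FreeGroup X)) (x : FreeGroup X)
    (hB : IsCanonicalBasis φ U {x} (fun _ => Y))
    (hYU : Cardinal.mk Y < Cardinal.mk U)
    (hU : Cardinal.mk U = Cardinal.mk X)
    (s : OutAut (FreeGroup X)) :
    s * toOut φ = toOut φ * s ↔
      ∃ σ : MulAut (FreeGroup X), toOut σ = s ∧ σ * φ = φ * σ := by
  constructor
  swap
  · rintro ⟨σ, rfl, h⟩
    rw [← map_mul, h, map_mul]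
  intro hs
  obtain ⟨σ, rfl⟩ := QuotientGroup.mk'_surjective (Inn (FreeGroup X)) s
  have hφφ : φ * φ = 1 := by rw [← sq, hφ.2]
  have hx : φ x = x⁻¹ := hB.2.2.1 x rfl
  have hbasis := hB.1.isBasis_singleton
  have hUsub : U ⊆ U ∪ {x} ∪ Y := fun u hu => Or.inl (Or.inl hu)
  have hUinf : Infinite U := Cardinal.infinite_iff.2 (hU ▸ Cardinal.aleph0_le_mk X)
  obtain ⟨a, b, hab⟩ := exists_pair_ne U
  have htriv (k : FreeGroup X) (hk : ∀ u ∈ U, Commute k u) : k = 1 :=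
    hbasis.eq_one_of_commute (hUsub a.2) (hUsub b.2) (fun h => hab (Subtype.ext h))
      (hk a a.2) (hk b b.2)
  have hconj : Function.Injective (MulAut.conj : FreeGroup X →* MulAut (FreeGroup X)) := by
    rw [injective_iff_map_eq_one]
    intro k hk
    refine htriv k fun u _ => mul_inv_eq_iff_eq_mul.1 ?_
    simpa using DFunLike.congr_fun hk u
  have hφout : φ ∉ Inn (FreeGroup X) := by
    rintro ⟨k, hk⟩
    refine hφ.1 ?_
    rw [← hk, htriv k, map_one]
    intro u hu
    refine mul_inv_eq_iff_eq_mul.1 ?_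
    simpa [hB.2.1 u hu] using DFunLike.congr_fun hk u
  obtain ⟨w, hw⟩ : σ * φ * σ⁻¹ * φ⁻¹ ∈ Inn (FreeGroup X) := by
    rw [← QuotientGroup.eq_one_iff]
    change toOut (σ * φ * σ⁻¹ * φ⁻¹) = 1
    rw [map_mul, map_mul, map_mul, map_inv, map_inv]
    exact mul_inv_eq_one.2 (mul_inv_eq_iff_eq_mul.2 hs)
  have hwσ : MulAut.conj w * φ = σ * φ * σ⁻¹ := by rw [hw, inv_mul_cancel_right]
  have hne : MulAut.conj w * φ ≠ 1 := by
    rw [hwσ, Ne, conj_eq_one_iff]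
    exact hφ.1
  have hcocycle : w * φ w = 1 := by
    apply hconj
    have hsq : (MulAut.conj w * φ) * (MulAut.conj w * φ) = 1 := by
      rw [hwσ]
      simp [mul_assoc, ← mul_assoc φ φ, hφφ]
    rwa [mul_assoc, ← mul_assoc φ, mul_conj_eq, mul_assoc, hφφ, mul_one, ← map_mul,
      ← map_one MulAut.conj] at hsq
  have hτ := blockAut_mul_self hφφ hx
  have hfix := blockAut_apply_of_mem hB
  obtain ⟨Φ, hΦ, hΦτ⟩ := exists_hom_factors hφφ hB
  obtain ⟨v, i, hv⟩ := exists_conj_of_mul_self_eq_one hconj hτ hfix Φ hΦ hΦτ (i := true)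
    hcocycle hne
  set ρ := factorHom (blockAut φ x) (blockFixed U Y) v
  replace hv : σ * φ * σ⁻¹ = ρ * blockAut φ x i * ρ⁻¹ := hwσ.symm.trans hv
  cases i
  · have hβout : blockAut φ x false ∉ Inn (FreeGroup X) := fun h =>
      hφout (((Inn _).mul_mem_cancel_left ⟨x⁻¹, rfl⟩).1 h)
    refine absurd (hbasis.mk_le_of_forall_mem_closure hUsub (ρ⁻¹ * σ) (Y := Y) ?_) hYU.not_ge
    intro u hu
    refine mem_closure_of_fixed hconj hτ hfix Φ hΦ hΦτ hβout ?_
    have hcomm : blockAut φ x false * (ρ⁻¹ * σ) = ρ⁻¹ * σ * φ := by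
      rw [mul_assoc ρ⁻¹, ← inv_mul_cancel_right (σ * φ) σ, hv]
      group
    have hcomm_u : blockAut φ x false ((ρ⁻¹ * σ) u) = (ρ⁻¹ * σ) (φ u) :=
      DFunLike.congr_fun hcomm u
    rwa [hB.2.1 u hu] at hcomm_u
  · have hmem : ρ ∈ Inn (FreeGroup X) ⊔ Subgroup.zpowers φ := factorHom_mem_sup v
    rw [Subgroup.mem_sup_of_normal_left] at hmem
    obtain ⟨γ, hγ, δ, ⟨n, rfl⟩, hγδ⟩ := hmem
    have hconjγ : σ * φ * σ⁻¹ = γ * φ * γ⁻¹ := by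
      rw [hv, ← hγδ, blockAut]
      group
    refine ⟨γ⁻¹ * σ, ?_, ?_⟩
    · change toOut (γ⁻¹ * σ) = toOut σ
      have h1 : toOut γ = 1 := (QuotientGroup.eq_one_iff γ).2 hγ
      rw [map_mul, map_inv, h1, inv_one, one_mul]
    · rw [mul_assoc, ← inv_mul_cancel_right (σ * φ) σ, hconjγ]
      group
end
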